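/- Let φ_i : ℝⁿ × ℝˡ → ℝ, i = 1,…,s, be C² around (x̄,p̄), C(p) := {x ∈ ℝⁿ : φ_i(x,p) ≤ 0, i = 1,…,s} with x̄ ∈ C(p̄), and suppose the partial Mangasarian–Fromovitz and constant rank constraint qualifications hold at (x̄,p̄). Let v̂ ∈ N_{C(p̄)}(x̄), where N is the limiting normal cone. Then the set-valued map p ↦ gph N_{C(p)}(·) = {(x,v) ∈ ℝⁿ × ℝⁿ : v ∈ N_{C(p)}(x)} is Lipschitz-like around (p̄,(x̄,v̂)). -/

import Mathlib

noncomputable section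

open Filter Topology Metric Set MeasureTheory
open scoped RealInnerProductSpace Pointwise

namespace PVS

variable {X : Type*} [NormedAddCommGroup X] [InnerProductSpace ℝ X]
variable {Y : Type*} [NormedAddCommGroup Y] [InnerProductSpace ℝ Y]
variable {W : Type*} [NormedAddCommGroup W] [InnerProductSpace ℝ W]
variable {P : Type*} [MetricSpace P]
variable {Q : Type*} [MetricSpace Q]

/-- Regular (Fréchet) subdifferential of an extended-real-valued function. -/
def regSubdiff (h : X → EReal) (x : X) : Set X :=
  {v | h x ≠ ⊤ ∧ h x ≠ ⊥ ∧ ∀ ε > (0:ℝ), ∀ᶠ u in 𝓝 x,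
      h x + ((⟪v, u - x⟫ - ε * ‖u - x‖ : ℝ) : EReal) ≤ h u}

/-- Weak sequential convergence in an inner product space. -/
def WeakTendsto (xs : ℕ → X) (x : X) : Prop :=
  ∀ z : X, Tendsto (fun k => ⟪xs k, z⟫) atTop (𝓝 ⟪x, z⟫)

/-- Limiting (Mordukhovich) subdifferential. -/
def limSubdiff (h : X → EReal) (x : X) : Set X :=
  {v | ∃ xs vs : ℕ → X, Tendsto xs atTop (𝓝 x) ∧
      Tendsto (fun k => h (xs k)) atTop (𝓝 (h x)) ∧
      (∀ k, vs k ∈ regSubdiff h (xs k)) ∧ WeakTendsto vs v}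

/-- Partial limiting subdifferential with respect to the first variable. -/
def pSubdiff {PP : Type*} (g : X → PP → EReal) (x : X) (p : PP) : Set X :=
  limSubdiff (fun x' => g x' p) x

/-- Graph of a set-valued map. -/
def gph (F : X → Set Y) : Set (X × Y) := {t | t.2 ∈ F t.1}

/-- Regular normal cone. -/
def regNC (Ω : Set X) (x : X) : Set X :=
  {v | ∀ ε > (0:ℝ), ∀ᶠ y in 𝓝[Ω] x, ⟪v, y - x⟫ ≤ ε * ‖y - x‖}

/-- Limiting normal cone. -/
def limNC (Ω : Set X) (x : X) : Set X :=
  {v | ∃ xs vs : ℕ → X, (∀ k, xs k ∈ Ω) ∧ Tendsto xs atTop (𝓝 x) ∧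
      (∀ k, vs k ∈ regNC Ω (xs k)) ∧ Tendsto vs atTop (𝓝 v)}

/-- Regular normal cone to a subset of a product of two inner product spaces,
with the Euclidean product norm. -/
def regNC2 (Ω : Set (X × Y)) (ω : X × Y) : Set (X × Y) :=
  {ζ | ∀ ε > (0:ℝ), ∀ᶠ y in 𝓝[Ω] ω,
      ⟪ζ.1, y.1 - ω.1⟫ + ⟪ζ.2, y.2 - ω.2⟫
        ≤ ε * Real.sqrt (‖y.1 - ω.1‖ ^ 2 + ‖y.2 - ω.2‖ ^ 2)}

/-- Limiting normal cone in a product of two spaces. -/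
def limNC2 (Ω : Set (X × Y)) (ω : X × Y) : Set (X × Y) :=
  {ζ | ∃ ωs ζs : ℕ → X × Y, (∀ k, ωs k ∈ Ω) ∧ Tendsto ωs atTop (𝓝 ω) ∧
      (∀ k, ζs k ∈ regNC2 Ω (ωs k)) ∧ Tendsto ζs atTop (𝓝 ζ)}

/-- Regular coderivative of a set-valued map. -/
def regCoderiv (F : X → Set Y) (u : X) (v : Y) (w : Y) : Set X :=
  {z | (z, -w) ∈ regNC2 (gph F) (u, v)}

/-- Limiting coderivative of a set-valued map. -/
def limCoderiv (F : X → Set Y) (u : X) (v : Y) (w : Y) : Set X :=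
  {z | (z, -w) ∈ limNC2 (gph F) (u, v)}

/-- Regular normal cone in a product of three inner product spaces. -/
def regNC3 (Ω : Set (X × W × Y)) (ω : X × W × Y) : Set (X × W × Y) :=
  {ζ | ∀ ε > (0:ℝ), ∀ᶠ y in 𝓝[Ω] ω,
      ⟪ζ.1, y.1 - ω.1⟫ + ⟪ζ.2.1, y.2.1 - ω.2.1⟫ + ⟪ζ.2.2, y.2.2 - ω.2.2⟫
        ≤ ε * Real.sqrt (‖y.1 - ω.1‖ ^ 2 + ‖y.2.1 - ω.2.1‖ ^ 2 + ‖y.2.2 - ω.2.2‖ ^ 2)}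

/-- Limiting normal cone in a product of three inner product spaces. -/
def limNC3 (Ω : Set (X × W × Y)) (ω : X × W × Y) : Set (X × W × Y) :=
  {ζ | ∃ ωs ζs : ℕ → X × W × Y, (∀ k, ωs k ∈ Ω) ∧ Tendsto ωs atTop (𝓝 ω) ∧
      (∀ k, ζs k ∈ regNC3 Ω (ωs k)) ∧ Tendsto ζs atTop (𝓝 ζ)}

/-- Limiting coderivative of the full partial subdifferential map (x,p) ↦ ∂ₓ g(x,p). -/
def limCoderivFull (g : X → W → EReal) (xb : X) (pb : W) (vh : X) (w : X) : Set (X × W) :=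
  {zs | (zs.1, zs.2, -w) ∈ limNC3 {t : X × W × X | t.2.2 ∈ pSubdiff g t.1 t.2.1} (xb, pb, vh)}

/-- Lipschitz-like (Aubin) property of a set-valued map around a graph point. -/
def LipschitzLike {α Z : Type*} [MetricSpace α] [SeminormedAddCommGroup Z]
    (F : α → Set Z) (ab : α) (zb : Z) : Prop :=
  ∃ ℓ > (0:ℝ), ∃ U ∈ 𝓝 ab, ∃ V ∈ 𝓝 zb,
    ∀ a ∈ U, ∀ a' ∈ U, ∀ z ∈ F a ∩ V, ∃ z' ∈ F a', ‖z - z'‖ ≤ ℓ * dist a a'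

/-- Epigraph of g(·,p). -/
def epi {PP : Type*} (g : X → PP → EReal) (p : PP) : Set (X × ℝ) :=
  {q | g q.1 p ≤ (q.2 : EReal)}

/-- (A1): Lipschitz continuity of the base around the reference point. -/
def A1 (f : X → P → Q → X) (xb : X) (pb : P) (qb : Q) : Prop :=
  ∃ L > (0:ℝ), ∃ ε > (0:ℝ), ∀ x₁ x₂ p₁ p₂ q₁ q₂,
    ‖x₁ - xb‖ < ε → ‖x₂ - xb‖ < ε → dist p₁ pb < ε → dist p₂ pb < ε →
    dist q₁ qb < ε → dist q₂ qb < ε →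
    ‖f x₁ p₁ q₁ - f x₂ p₂ q₂‖ ≤ L * (‖x₁ - x₂‖ + dist p₁ p₂ + dist q₁ q₂)

/-- Parametric prox-regularity with prox-parameter r. -/
def ProxRegWith (g : X → P → EReal) (xb : X) (pb : P) (vh : X) (r : ℝ) : Prop :=
  ∃ ε > (0:ℝ), ∀ x u p v, ‖x - xb‖ < ε → ‖u - xb‖ < ε → dist p pb < ε → ‖v - vh‖ < ε →
    v ∈ pSubdiff g u p →
    g u p + ((⟪v, x - u⟫ - r / 2 * ‖x - u‖ ^ 2 : ℝ) : EReal) ≤ g x p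

/-- Subdifferential continuity with compatible parameterization. -/
def SubdiffCont (g : X → P → EReal) (xb : X) (pb : P) (vh : X) : Prop :=
  Tendsto (fun t : X × P × X => g t.1 t.2.1)
    (𝓝[{t : X × P × X | t.2.2 ∈ pSubdiff g t.1 t.2.1}] (xb, pb, vh)) (𝓝 (g xb pb))

/-- (A2): parametric continuous prox-regularity. -/
def A2 (g : X → P → EReal) (xb : X) (pb : P) (vh : X) : Prop :=
  (∃ r > (0:ℝ), ProxRegWith g xb pb vh r) ∧ SubdiffCont g xb pb vh

/-- Threshold of prox-regularity. -/
def proxThreshold (g : X → P → EReal) (xb : X) (pb : P) (vh : X) : ℝ :=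
  sInf {r : ℝ | 0 < r ∧ ProxRegWith g xb pb vh r}

/-- (A3): basic constraint qualification. -/
def A3 (g : X → P → EReal) (xb : X) (pb : P) : Prop :=
  LipschitzLike (fun p => epi g p) pb (xb, (g xb pb).toReal)

/-- (A4): uniform partial differentiability with partial Jacobian continuous at the point. -/
def A4 (f : X → P → Q → X) (Df : X → P → Q → X →L[ℝ] X) (xb : X) (pb : P) (qb : Q) : Prop :=
  (∃ η > (0:ℝ), ∀ ε > (0:ℝ), ∃ δ > (0:ℝ), ∀ x p q,
      ‖x - xb‖ < η → dist p pb < η → dist q qb < η →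
      ∀ x', ‖x' - x‖ < δ →
        ‖f x' p q - f x p q - Df x p q (x' - x)‖ ≤ ε * ‖x' - x‖) ∧
  Tendsto (fun t : X × P × Q => Df t.1 t.2.1 t.2.2) (𝓝 (xb, pb, qb)) (𝓝 (Df xb pb qb))

/-- Solution map of the parametric variational system. -/
def SolMap (f : X → P → Q → X) (g : X → P → EReal) (v : X) (p : P) (q : Q) : Set X :=
  {x | v - f x p q ∈ pSubdiff g x p}

/-- Single-valued localization of a three-parametric solution map. -/
def Localizes3 (S : X → P → Q → Set X) (V : Set X) (Pn : Set P) (Qn : Set Q) (U : Set X)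
    (ϑ : X → P → Q → X) : Prop :=
  ∀ v ∈ V, ∀ p ∈ Pn, ∀ q ∈ Qn,
    ϑ v p q ∈ U ∧ ϑ v p q ∈ S v p q ∧ ∀ x ∈ U, x ∈ S v p q → x = ϑ v p q

/-- Lipschitzian full stability. -/
def LipFullStable (S : X → P → Q → Set X) (xb vb : X) (pb : P) (qb : Q) : Prop :=
  ∃ V ∈ 𝓝 vb, ∃ Pn ∈ 𝓝 pb, ∃ Qn ∈ 𝓝 qb, ∃ U ∈ 𝓝 xb, ∃ ϑ : X → P → Q → X,
    Localizes3 S V Pn Qn U ϑ ∧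
    ∃ κ > (0:ℝ), ∃ ℓ > (0:ℝ), ∀ v₁ ∈ V, ∀ p₁ ∈ Pn, ∀ q₁ ∈ Qn, ∀ v₂ ∈ V, ∀ p₂ ∈ Pn, ∀ q₂ ∈ Qn,
      ‖(v₁ - v₂) - (2 * κ) • (ϑ v₁ p₁ q₁ - ϑ v₂ p₂ q₂)‖
        ≤ ‖v₁ - v₂‖ + ℓ * (dist p₁ p₂ + dist q₁ q₂)

/-- Hölderian full stability with given moduli. -/
def HolderFullStableWith (S : X → P → Q → Set X) (xb vb : X) (pb : P) (qb : Q) (κ ℓ : ℝ) : Prop :=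
  ∃ V ∈ 𝓝 vb, ∃ Pn ∈ 𝓝 pb, ∃ Qn ∈ 𝓝 qb, ∃ U ∈ 𝓝 xb, ∃ ϑ : X → P → Q → X,
    Localizes3 S V Pn Qn U ϑ ∧
    ∀ v₁ ∈ V, ∀ p₁ ∈ Pn, ∀ q₁ ∈ Qn, ∀ v₂ ∈ V, ∀ p₂ ∈ Pn, ∀ q₂ ∈ Qn,
      ‖(v₁ - v₂) - (2 * κ) • (ϑ v₁ p₁ q₁ - ϑ v₂ p₂ q₂)‖
        ≤ ‖v₁ - v₂‖ + ℓ * (Real.sqrt (dist p₁ p₂) + dist q₁ q₂)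

/-- Hölderian full stability. -/
def HolderFullStable (S : X → P → Q → Set X) (xb vb : X) (pb : P) (qb : Q) : Prop :=
  ∃ κ > (0:ℝ), ∃ ℓ > (0:ℝ), HolderFullStableWith S xb vb pb qb κ ℓ

/-- Neighborhood second-order condition via the regular coderivative of ∂g_p. -/
def SOC (g : X → P → EReal) (A : X →L[ℝ] X) (xb : X) (pb : P) (vh : X) (η κ₀ : ℝ) : Prop :=
  ∀ u p v, ‖u - xb‖ ≤ η → dist p pb ≤ η → ‖v - vh‖ ≤ η → v ∈ pSubdiff g u p →
    ∀ w z, z ∈ regCoderiv (fun y => pSubdiff g y p) u v w →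
      κ₀ * ‖w‖ ^ 2 ≤ ⟪A w, w⟫ + ⟪z, w⟫

/-- The graphical map p ↦ gph ∂ₓ g(·,p). -/
def gphMap (g : X → P → EReal) (p : P) : Set (X × X) := {t | t.2 ∈ pSubdiff g t.1 p}

/-- Local strong monotonicity of f in x with modulus σ. -/
def StrongMono (f : X → P → Q → X) (xb : X) (pb : P) (qb : Q) (σ : ℝ) : Prop :=
  ∃ ε > (0:ℝ), ∀ x₁ x₂ p q, ‖x₁ - xb‖ < ε → ‖x₂ - xb‖ < ε → dist p pb < ε → dist q qb < ε →
    σ * ‖x₁ - x₂‖ ^ 2 ≤ ⟪f x₁ p q - f x₂ p q, x₁ - x₂⟫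

/-- The proximal mapping P_λ(v,p) = {x : v ∈ x + λ ∂ₓ g(x,p)}. -/
def proxMap (g : X → P → EReal) (lam : ℝ) (v : X) (p : P) : Set X :=
  {x | ∃ s ∈ pSubdiff g x p, v = x + lam • s}

/-- Single-valued localization of a two-parametric solution map. -/
def Localizes2 (S : X → P → Set X) (V : Set X) (Pn : Set P) (U : Set X) (ϑ : X → P → X) : Prop :=
  ∀ v ∈ V, ∀ p ∈ Pn, ϑ v p ∈ U ∧ ϑ v p ∈ S v p ∧ ∀ x ∈ U, x ∈ S v p → x = ϑ v p

/-- (Lipschitzian) full stability of a two-parametric system. -/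
def FullStable2 (S : X → P → Set X) (xb vb : X) (pb : P) : Prop :=
  ∃ V ∈ 𝓝 vb, ∃ Pn ∈ 𝓝 pb, ∃ U ∈ 𝓝 xb, ∃ ϑ : X → P → X,
    Localizes2 S V Pn U ϑ ∧
    ∃ κ > (0:ℝ), ∃ ℓ > (0:ℝ), ∀ v₁ ∈ V, ∀ p₁ ∈ Pn, ∀ v₂ ∈ V, ∀ p₂ ∈ Pn,
      ‖(v₁ - v₂) - (2 * κ) • (ϑ v₁ p₁ - ϑ v₂ p₂)‖ ≤ ‖v₁ - v₂‖ + ℓ * dist p₁ p₂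

/-- Normal cone of convex analysis. -/
def convNC (C : Set X) (x : X) : Set X := {v | x ∈ C ∧ ∀ y ∈ C, ⟪v, y - x⟫ ≤ 0}

/-- Solution map of a parametric variational inequality. -/
def SolMapVI (f : X → P → X) (C : Set X) (v : X) (p : P) : Set X :=
  {x | v - f x p ∈ convNC C x}

/-- Radial cone. -/
def radialCone (C : Set X) (x : X) : Set X := {w | ∃ t > (0:ℝ), x + t • w ∈ C}

/-- Tangent cone (closure of the radial cone). -/
def tangentC (C : Set X) (x : X) : Set X := closure (radialCone C x)

/-- Critical cone. -/
def criticalCone (C : Set X) (x v : X) : Set X := tangentC C x ∩ {w | ⟪v, w⟫ = 0}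

/-- Polyhedricity of a closed convex set. -/
def Polyhedric (C : Set X) : Prop :=
  ∀ x ∈ C, ∀ v ∈ convNC C x,
    criticalCone C x v = closure (radialCone C x ∩ {w | ⟪v, w⟫ = 0})

/-- Weak sequential outer limit of critical cones. -/
def Hw (C : Set X) (xb vh : X) : Set X :=
  {w | ∃ xs vs ws : ℕ → X, (∀ k, vs k ∈ convNC C (xs k)) ∧
      Tendsto xs atTop (𝓝 xb) ∧ Tendsto vs atTop (𝓝 vh) ∧
      (∀ k, ws k ∈ criticalCone C (xs k) (vs k)) ∧ WeakTendsto ws w}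

/-- Strong sequential outer limit of critical cones. -/
def Hs (C : Set X) (xb vh : X) : Set X :=
  {w | ∃ xs vs ws : ℕ → X, (∀ k, vs k ∈ convNC C (xs k)) ∧
      Tendsto xs atTop (𝓝 xb) ∧ Tendsto vs atTop (𝓝 vh) ∧
      (∀ k, ws k ∈ criticalCone C (xs k) (vs k)) ∧ Tendsto ws atTop (𝓝 w)}

/-- Convex polyhedron: finite intersection of closed half-spaces. -/
def IsPolyhedron (C : Set X) : Prop :=
  ∃ (k : ℕ) (a : Fin k → X) (b : Fin k → ℝ), C = {x | ∀ i, ⟪a i, x⟫ ≤ b i}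

/-- Legendre form. -/
def LegendreForm (Qf : X → ℝ) : Prop :=
  (∃ A : X →L[ℝ] X, ∀ x, Qf x = ⟪A x, x⟫) ∧
  (∀ (xs : ℕ → X) (x : X), WeakTendsto xs x → Qf x ≤ liminf (fun k => Qf (xs k)) atTop) ∧
  (∀ (xs : ℕ → X) (x : X), WeakTendsto xs x →
     Tendsto (fun k => Qf (xs k)) atTop (𝓝 (Qf x)) → Tendsto xs atTop (𝓝 x))

/-- (A1) for a two-parametric base mapping. -/
def A1two (f : X → P → X) (xb : X) (pb : P) : Prop :=
  ∃ L > (0:ℝ), ∃ ε > (0:ℝ), ∀ x₁ x₂ p₁ p₂,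
    ‖x₁ - xb‖ < ε → ‖x₂ - xb‖ < ε → dist p₁ pb < ε → dist p₂ pb < ε →
    ‖f x₁ p₁ - f x₂ p₂‖ ≤ L * (‖x₁ - x₂‖ + dist p₁ p₂)

/-- (A4) for a two-parametric base mapping. -/
def A4two (f : X → P → X) (Df : X → P → X →L[ℝ] X) (xb : X) (pb : P) : Prop :=
  (∃ η > (0:ℝ), ∀ ε > (0:ℝ), ∃ δ > (0:ℝ), ∀ x p,
      ‖x - xb‖ < η → dist p pb < η →
      ∀ x', ‖x' - x‖ < δ → ‖f x' p - f x p - Df x p (x' - x)‖ ≤ ε * ‖x' - x‖) ∧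
  Tendsto (fun t : X × P => Df t.1 t.2) (𝓝 (xb, pb)) (𝓝 (Df xb pb))

/-- Euclidean distance in X × ℝ. -/
def pairDist (a b : X × ℝ) : ℝ := Real.sqrt (‖a.1 - b.1‖ ^ 2 + |a.2 - b.2| ^ 2)

/-- Pompeiu–Hausdorff distance between subsets of X × ℝ (Euclidean product norm). -/
def hausPH (C₁ C₂ : Set (X × ℝ)) : ℝ :=
  sInf {η : ℝ | 0 ≤ η ∧ (∀ a ∈ C₁, ∃ b ∈ C₂, pairDist a b ≤ η) ∧
                 ∀ b ∈ C₂, ∃ a ∈ C₁, pairDist a b ≤ η}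

/-- Nonparametric prox-regularity with parameter r. -/
def ProxRegWithNP (g : X → EReal) (xb vh : X) (r : ℝ) : Prop :=
  ∃ ε > (0:ℝ), ∀ x u v, ‖x - xb‖ < ε → ‖u - xb‖ < ε → ‖v - vh‖ < ε →
    v ∈ limSubdiff g u → g u ≤ g xb + (ε : EReal) →
    g u + ((⟪v, x - u⟫ - r / 2 * ‖x - u‖ ^ 2 : ℝ) : EReal) ≤ g x

/-- Nonparametric subdifferential continuity. -/
def SubdiffContNP (g : X → EReal) (xb vh : X) : Prop :=
  Tendsto (fun t : X × X => g t.1) (𝓝[gph (limSubdiff g)] (xb, vh)) (𝓝 (g xb))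

/-- Nonparametric threshold of prox-regularity. -/
def proxThresholdNP (g : X → EReal) (xb vh : X) : ℝ :=
  sInf {r : ℝ | 0 < r ∧ ProxRegWithNP g xb vh r}


/-- A continuous curve whose parameter interval is covered by finitely many classes, on each of
which it is `K`-Lipschitz, satisfies the `K`-Lipschitz estimate. -/
lemma norm_sub_le_of_finite_pieces {E T : Type*} [NormedAddCommGroup E] [DecidableEq T]
    {f : ℝ → E} {c : ℝ → T} {K b : ℝ}
    (S : Finset T) (a : ℝ) (hab : a ≤ b) (hf : ContinuousOn f (Icc a b))
    (hc : ∀ τ ∈ Icc a b, c τ ∈ S)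
    (hL : ∀ τ ∈ Icc a b, ∀ σ ∈ Icc a b, c τ = c σ → ‖f τ - f σ‖ ≤ K * |τ - σ|) :
    ‖f a - f b‖ ≤ K * (b - a) := by
  induction hm : S.card generalizing S a with
  | zero =>
    have := hc a (left_mem_Icc.2 hab)
    simp [Finset.card_eq_zero.1 hm] at this
  | succ m ih =>
    have haI : a ∈ Icc a b := left_mem_Icc.2 hab
    set A := {τ ∈ Icc a b | c τ = c a} with hA
    have haA : a ∈ A := ⟨haI, rfl⟩
    have hAb : BddAbove A := ⟨b, fun τ hτ => hτ.1.2⟩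
    set σ := sSup A with hσ
    have haσ : a ≤ σ := le_csSup hAb haA
    have hσb : σ ≤ b := csSup_le ⟨a, haA⟩ fun τ hτ => hτ.1.2
    have hσI : σ ∈ Icc a b := ⟨haσ, hσb⟩
    have h1 : ‖f a - f σ‖ ≤ K * (σ - a) := by
      obtain ⟨u, -, hu, huA⟩ := exists_seq_tendsto_sSup ⟨a, haA⟩ hAb
      have hu' : Tendsto u atTop (𝓝[Icc a b] σ) :=
        tendsto_nhdsWithin_iff.2 ⟨hu, Eventually.of_forall fun k => (huA k).1⟩
      have hfu : Tendsto (fun k => f (u k)) atTop (𝓝 (f σ)) := (hf σ hσI).tendsto.comp hu'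
      refine le_of_tendsto_of_tendsto' (tendsto_const_nhds.sub hfu).norm
        ((hu.sub_const a).const_mul K) fun k => ?_
      have := hL a haI (u k) (huA k).1 (huA k).2.symm
      rwa [abs_sub_comm, abs_of_nonneg (sub_nonneg.2 (huA k).1.1)] at this
    rcases hσb.eq_or_lt with hσeq | hσlt
    · rwa [hσeq] at h1
    have h2 : ‖f σ - f b‖ ≤ K * (b - σ) := by
      have hten : Tendsto f (𝓝[Ioo σ b] σ) (𝓝 (f σ)) :=
        (hf σ hσI).mono fun τ hτ => ⟨haσ.trans hτ.1.le, hτ.2.le⟩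
      have hten2 : Tendsto (fun τ => K * (b - τ)) (𝓝[Ioo σ b] σ) (𝓝 (K * (b - σ))) := by
        have : ContinuousAt (fun τ => K * (b - τ)) σ := by fun_prop
        exact this.tendsto.mono_left nhdsWithin_le_nhds
      have : (𝓝[Ioo σ b] σ).NeBot := left_nhdsWithin_Ioo_neBot hσlt
      refine le_of_tendsto_of_tendsto (hten.sub_const _).norm hten2 ?_
      filter_upwards [self_mem_nhdsWithin] with τ hτ
      have hsub : Icc τ b ⊆ Icc a b := Icc_subset_Icc_left (haσ.trans hτ.1.le)
      refine ih (S.erase (c a)) τ hτ.2.le (hf.mono hsub) (fun θ hθ => ?_)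
        (fun θ hθ θ' hθ' => hL θ (hsub hθ) θ' (hsub hθ')) ?_
      · refine Finset.mem_erase.2 ⟨fun hcθ => ?_, hc θ (hsub hθ)⟩
        have : θ ≤ σ := le_csSup hAb ⟨hsub hθ, hcθ⟩
        linarith [hθ.1, hτ.1]
      · rw [Finset.card_erase_of_mem (hc a haI), hm]
        rfl
    calc ‖f a - f b‖ ≤ ‖f a - f σ‖ + ‖f σ - f b‖ := norm_sub_le_norm_sub_add_norm_sub _ _ _
      _ ≤ K * (b - a) := by linarith

section ConstraintSystem

variable {E F ι : Type*} [NormedAddCommGroup E] [InnerProductSpace ℝ E] [Fintype ι]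

/-- The cone generated by the gradients `g i x p` of the active constraints. -/
def multCone (φ : ι → E → F → ℝ) (g : ι → E → F → E) (x : E) (p : F) : Set E :=
  {v | ∃ lam : ι → ℝ, (∀ i, 0 ≤ lam i) ∧ (∀ i, lam i * φ i x p = 0) ∧
    v = ∑ i, lam i • g i x p}

/-- Carathéodory's theorem for finitely generated cones. -/
lemma exists_nonneg_linearIndepOn_support (a : ι → E) (lam : ι → ℝ) (hlam : ∀ i, 0 ≤ lam i) :
    ∃ (J : Finset ι) (μ : ι → ℝ), (∀ i, 0 ≤ μ i) ∧ (∀ i, i ∉ J → μ i = 0) ∧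
      (∀ i ∈ J, lam i ≠ 0) ∧ ∑ i, μ i • a i = ∑ i, lam i • a i ∧
      LinearIndepOn ℝ a (J : Set ι) := by
  classical
  generalize hm : (Finset.univ.filter fun i => lam i ≠ 0).card = m
  induction m using Nat.strong_induction_on generalizing lam with
  | _ m ih =>
  set J := Finset.univ.filter fun i => lam i ≠ 0 with hJ
  have hmem : ∀ i, i ∈ J ↔ lam i ≠ 0 := by simp [hJ]
  by_cases hind : LinearIndepOn ℝ a (J : Set ι)
  · exact ⟨J, lam, hlam, fun i hi => by simpa [hmem] using hi, fun i hi => (hmem i).1 hi, rfl, hind⟩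
  rw [linearIndepOn_finset_iff] at hind
  push Not at hind
  obtain ⟨c', hc'sum, i', hi'J, hi'⟩ := hind
  obtain ⟨c, hcsum, hpos⟩ : ∃ c : ι → ℝ, ∑ i ∈ J, c i • a i = 0 ∧ ∃ i ∈ J, 0 < c i := by
    rcases lt_or_gt_of_ne hi' with h | h
    · exact ⟨fun i => -c' i, by simp [hc'sum], i', hi'J, by simpa using h⟩
    · exact ⟨c', hc'sum, i', hi'J, h⟩
  set K := J.filter fun i => 0 < c i with hK
  have hKne : K.Nonempty := by
    obtain ⟨i, hi, hci⟩ := hpos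
    exact ⟨i, by simp [hK, hi, hci]⟩
  obtain ⟨k, hkK, hkmin⟩ := K.exists_min_image (fun i => lam i / c i) hKne
  have hkJ : k ∈ J := (Finset.mem_filter.1 hkK).1
  have hck : 0 < c k := (Finset.mem_filter.1 hkK).2
  set θ := lam k / c k with hθ
  have hθ0 : 0 ≤ θ := div_nonneg (hlam k) hck.le
  let ν : ι → ℝ := fun i => if i ∈ J then lam i - θ * c i else 0
  have hν0 : ∀ i, 0 ≤ ν i := by
    intro i
    by_cases hi : i ∈ J
    · simp only [ν, hi, if_true]
      by_cases hci : 0 < c i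
      · have h1 := hkmin i (by simp [hK, hi, hci])
        have h2 : θ * c i ≤ lam i := by
          simpa [hθ] using (le_div_iff₀ hci).1 h1
        linarith
      · nlinarith [hlam i, mul_nonneg hθ0 (neg_nonneg.2 (not_lt.1 hci))]
    · simp [ν, hi]
  have hνsub : ∀ i, ν i ≠ 0 → i ∈ J := by
    intro i hi
    by_contra h
    simp [ν, h] at hi
  have hνk : ν k = 0 := by
    simp only [ν, hkJ, if_true, hθ]
    field_simp
    ring
  have hsum : ∑ i, ν i • a i = ∑ i, lam i • a i := by
    have h1 : ∑ i, ν i • a i = ∑ i ∈ J, ν i • a i :=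
      (Finset.sum_subset (Finset.subset_univ J) fun i _ hi => by simp [ν, hi]).symm
    have h2 : ∑ i, lam i • a i = ∑ i ∈ J, lam i • a i :=
      (Finset.sum_subset (Finset.subset_univ J) fun i _ hi => by
        have : lam i = 0 := by simpa [hmem] using hi
        simp [this]).symm
    rw [h1, h2]
    have h3 : ∑ i ∈ J, ν i • a i = ∑ i ∈ J, (lam i • a i - θ • (c i • a i)) :=
      Finset.sum_congr rfl fun i hi => by simp [ν, hi, sub_smul, mul_smul]
    rw [h3, Finset.sum_sub_distrib, ← Finset.smul_sum, hcsum, smul_zero, sub_zero]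
  have hcard : (Finset.univ.filter fun i => ν i ≠ 0).card < m := by
    rw [← hm]
    apply Finset.card_lt_card
    refine ⟨fun i hi => hνsub i (by simpa using hi), fun hsub => ?_⟩
    have := hsub hkJ
    simp [hνk] at this
  obtain ⟨J', μ, h1, h2, h3, h4, h5⟩ := ih _ hcard ν hν0 rfl
  exact ⟨J', μ, h1, h2, fun i hi => (hmem i).1 (hνsub i (h3 i hi)), h4.trans hsum, h5⟩

lemma exists_indep_of_mem_multCone {φ : ι → E → F → ℝ} {g : ι → E → F → E} {x : E} {p : F} {v : E}
    (hv : v ∈ multCone φ g x p) :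
    ∃ (J : Finset ι) (lam : ι → ℝ), (∀ i, 0 ≤ lam i) ∧ (∀ i, i ∉ J → lam i = 0) ∧
      (∀ i ∈ J, φ i x p = 0) ∧ v = ∑ i, lam i • g i x p ∧
      LinearIndepOn ℝ (fun i => g i x p) (J : Set ι) := by
  obtain ⟨lam, h0, hc, rfl⟩ := hv
  obtain ⟨J, μ, h1, h2, h3, h4, h5⟩ := exists_nonneg_linearIndepOn_support (fun i => g i x p) lam h0
  exact ⟨J, μ, h1, h2, fun i hi => (mul_eq_zero.1 (hc i)).resolve_left (h3 i hi), h4.symm, h5⟩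

variable [NormedAddCommGroup F]

/-- Uniform quantitative estimates for a constraint system `φ` with partial gradients `g` on a
product of balls: Lipschitz and Taylor bounds, a common descent direction `d` for all constraints
that may be active, and uniform independence of the active gradients. -/
structure ConstraintBounds (φ : ι → E → F → ℝ) (g : ι → E → F → E) (xb : E) (pb : F)
    (d : E) (r M L κ : ℝ) : Prop where
  r_pos : 0 < r
  M_pos : 0 < M
  L_pos : 0 < L
  κ_pos : 0 < κ
  lip_param : ∀ i, ∀ x ∈ ball xb r, ∀ p ∈ ball pb r, ∀ q ∈ ball pb r,
    |φ i x p - φ i x q| ≤ M * ‖p - q‖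
  taylor : ∀ i, ∀ p ∈ ball pb r, ∀ x ∈ ball xb r, ∀ y ∈ ball xb r,
    |φ i y p - φ i x p - ⟪g i x p, y - x⟫| ≤ L * ‖y - x‖ ^ 2
  lip_grad : ∀ i, ∀ x ∈ ball xb r, ∀ y ∈ ball xb r, ∀ p ∈ ball pb r, ∀ q ∈ ball pb r,
    ‖g i x p - g i y q‖ ≤ L * (‖x - y‖ + ‖p - q‖)
  descent : ∀ i, (∀ x ∈ ball xb r, ∀ p ∈ ball pb r, φ i x p < 0) ∨
    ∀ x ∈ ball xb r, ∀ p ∈ ball pb r, ⟪g i x p, d⟫ ≤ -1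
  indep : ∀ J : Finset ι, (∃ x ∈ ball xb r, ∃ p ∈ ball pb r, (∀ i ∈ J, φ i x p = 0) ∧
      LinearIndepOn ℝ (fun i => g i x p) (J : Set ι)) →
    ∀ y ∈ ball xb r, ∀ q ∈ ball pb r, ∀ μ : ι → ℝ, (∀ i, i ∉ J → μ i = 0) →
      κ * ∑ i, |μ i| ≤ ‖∑ i, μ i • g i y q‖

namespace ConstraintBounds

variable {φ : ι → E → F → ℝ} {g : ι → E → F → E} {xb : E} {pb : F} {d : E} {r M L κ : ℝ}

lemma sum_mult_le (h : ConstraintBounds φ g xb pb d r M L κ) {x : E} {p : F}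
    (hx : x ∈ ball xb r) (hp : p ∈ ball pb r) {lam : ι → ℝ} (h0 : ∀ i, 0 ≤ lam i)
    (hc : ∀ i, lam i * φ i x p = 0) :
    ∑ i, lam i ≤ ‖∑ i, lam i • g i x p‖ * ‖d‖ := by
  have h1 : ⟪∑ i, lam i • g i x p, d⟫ ≤ -∑ i, lam i := by
    rw [sum_inner, ← Finset.sum_neg_distrib]
    refine Finset.sum_le_sum fun i _ => ?_
    rw [inner_smul_left]
    simp only [conj_trivial]
    rcases h.descent i with hi | hi
    · have : lam i = 0 := (mul_eq_zero.1 (hc i)).resolve_right (hi x hx p hp).ne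
      simp [this]
    · nlinarith [hi x hx p hp, h0 i]
  have h2 := neg_le_of_abs_le (abs_real_inner_le_norm (∑ i, lam i • g i x p) d)
  linarith

/-- Parametric prox-regularity of the feasible sets, in terms of multipliers. -/
lemma inner_le_of_feasible (h : ConstraintBounds φ g xb pb d r M L κ) {x y v : E} {p q : F}
    (hx : x ∈ ball xb r) (hy : y ∈ ball xb r) (hp : p ∈ ball pb r) (hq : q ∈ ball pb r)
    (hv : v ∈ multCone φ g x p) (hyq : ∀ i, φ i y q ≤ 0) :
    ⟪v, y - x⟫ ≤ ‖v‖ * ‖d‖ * (M * ‖p - q‖ + L * ‖y - x‖ ^ 2) := by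
  obtain ⟨lam, h0, hc, rfl⟩ := hv
  have hs := h.sum_mult_le hx hp h0 hc
  have hB : 0 ≤ M * ‖p - q‖ + L * ‖y - x‖ ^ 2 := by
    have := h.M_pos; have := h.L_pos; positivity
  refine le_trans ?_ (mul_le_mul_of_nonneg_right hs hB)
  rw [sum_inner, Finset.sum_mul]
  refine Finset.sum_le_sum fun i _ => ?_
  rw [inner_smul_left]
  simp only [conj_trivial]
  have h1 := abs_le.1 (h.taylor i p hp x hx y hy)
  have h2 := abs_le.1 (h.lip_param i y hy p hp q hq)
  have h3 : ⟪g i x p, y - x⟫ ≤ M * ‖p - q‖ + L * ‖y - x‖ ^ 2 - φ i x p := by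
    linarith [hyq i, h1.1, h2.2]
  nlinarith [mul_le_mul_of_nonneg_left h3 (h0 i), hc i]

/-- Hölder estimate for pairs on the normal cone graphs with a common value of `x + t v`. -/
lemma sq_norm_sub_le (h : ConstraintBounds φ g xb pb d r M L κ) {x y v w : E} {p q : F} {t R : ℝ}
    (hx : x ∈ ball xb r) (hy : y ∈ ball xb r) (hp : p ∈ ball pb r) (hq : q ∈ ball pb r)
    (hv : v ∈ multCone φ g x p) (hw : w ∈ multCone φ g y q)
    (hxp : ∀ i, φ i x p ≤ 0) (hyq : ∀ i, φ i y q ≤ 0) (hvR : ‖v‖ * ‖d‖ ≤ R) (hwR : ‖w‖ * ‖d‖ ≤ R)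
    (ht : 0 < t) (htR : t * R * L ≤ 1 / 8) (hz : x + t • v = y + t • w) :
    ‖x - y‖ ^ 2 ≤ 4 * t * R * M * ‖p - q‖ := by
  have h1 := h.inner_le_of_feasible hx hy hp hq hv hyq
  have h2 := h.inner_le_of_feasible hy hx hq hp hw hxp
  have hB : 0 ≤ M * ‖p - q‖ + L * ‖x - y‖ ^ 2 := by
    have := h.M_pos; have := h.L_pos; positivity
  rw [norm_sub_rev q p] at h2
  rw [norm_sub_rev y x] at h1
  have h3 : t * (⟪v, y - x⟫ + ⟪w, x - y⟫) = ‖x - y‖ ^ 2 := by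
    have e1 : x - y = t • w - t • v := by
      rw [sub_eq_sub_iff_add_eq_add, hz, add_comm]
    have e2 : ⟪v, y - x⟫ = - ⟪v, x - y⟫ := by rw [← inner_neg_right, neg_sub]
    rw [e2, ← real_inner_self_eq_norm_sq]
    conv_rhs => rw [e1, inner_sub_left, inner_smul_left, inner_smul_left, ← e1]
    simp only [conj_trivial]
    ring
  have h4 : ⟪v, y - x⟫ + ⟪w, x - y⟫ ≤ 2 * R * (M * ‖p - q‖ + L * ‖x - y‖ ^ 2) := by
    nlinarith [mul_le_mul_of_nonneg_right hvR hB, mul_le_mul_of_nonneg_right hwR hB]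
  have hR : 0 ≤ R := le_trans (by positivity) hvR
  nlinarith [mul_le_mul_of_nonneg_left h4 ht.le, mul_le_mul_of_nonneg_right htR (sq_nonneg ‖x - y‖),
    mul_nonneg (mul_nonneg ht.le hR) (mul_nonneg h.M_pos.le (norm_nonneg (p - q)))]

/-- Lipschitz estimate for pairs on the normal cone graphs with a common value of `x + t v` whose
multipliers are supported on a common set of independent active gradients. -/
lemma norm_sub_le_of_common_support (h : ConstraintBounds φ g xb pb d r M L κ) {x y v w : E}
    {p q : F} {t R : ℝ} {J : Finset ι} {lam μ : ι → ℝ}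
    (hx : x ∈ ball xb r) (hy : y ∈ ball xb r) (hp : p ∈ ball pb r) (hq : q ∈ ball pb r)
    (hl0 : ∀ i, 0 ≤ lam i) (hlJ : ∀ i, i ∉ J → lam i = 0) (hxJ : ∀ i ∈ J, φ i x p = 0)
    (hv : v = ∑ i, lam i • g i x p) (hind : LinearIndepOn ℝ (fun i => g i x p) (J : Set ι))
    (hm0 : ∀ i, 0 ≤ μ i) (hmJ : ∀ i, i ∉ J → μ i = 0) (hyJ : ∀ i ∈ J, φ i y q = 0)
    (hw : w = ∑ i, μ i • g i y q) (hvR : ‖v‖ * ‖d‖ ≤ R) (hwR : ‖w‖ * ‖d‖ ≤ R)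
    (ht : 0 < t) (htR : t * R * L ≤ 1 / 8) (hz : x + t • v = y + t • w) :
    ‖x - y‖ ≤ (2 * M / κ + 1) * ‖p - q‖ := by
  have hM := h.M_pos
  have hL := h.L_pos
  have hκ := h.κ_pos
  have hR : 0 ≤ R := le_trans (by positivity) hvR
  have hsl : ∑ i, lam i ≤ R := by
    refine (h.sum_mult_le hx hp hl0 fun i => ?_).trans (hv ▸ hvR)
    by_cases hi : i ∈ J
    · simp [hxJ i hi]
    · simp [hlJ i hi]
  have hsm : ∑ i, μ i ≤ R := by
    refine (h.sum_mult_le hy hq hm0 fun i => ?_).trans (hw ▸ hwR)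
    by_cases hi : i ∈ J
    · simp [hyJ i hi]
    · simp [hmJ i hi]
  set S := ∑ i, |lam i - μ i| with hS
  have hS0 : 0 ≤ S := Finset.sum_nonneg fun i _ => abs_nonneg _
  have hSR : S ≤ 2 * R := by
    have : S ≤ ∑ i, (lam i + μ i) := Finset.sum_le_sum fun i _ => by
      rw [abs_le]; constructor <;> linarith [hl0 i, hm0 i]
    rw [Finset.sum_add_distrib] at this
    linarith
  set X := ‖x - y‖ with hX
  set D := ‖p - q‖ with hD
  have hX0 : 0 ≤ X := norm_nonneg _
  have hD0 : 0 ≤ D := norm_nonneg _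
  have e1 : x - y = t • w - t • v := by
    rw [sub_eq_sub_iff_add_eq_add, hz, add_comm]
  have hvw : v - w = ∑ i, (lam i - μ i) • g i x p + ∑ i, μ i • (g i x p - g i y q) := by
    rw [hv, hw, ← Finset.sum_add_distrib, ← Finset.sum_sub_distrib]
    refine Finset.sum_congr rfl fun i _ => ?_
    rw [sub_smul, smul_sub]; abel
  have hN : ‖∑ i, μ i • (g i x p - g i y q)‖ ≤ R * (L * (X + D)) := by
    refine (norm_sum_le _ _).trans ?_
    refine le_trans ?_ (mul_le_mul_of_nonneg_right hsm (by positivity))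
    rw [Finset.sum_mul]
    refine Finset.sum_le_sum fun i _ => ?_
    rw [norm_smul, Real.norm_of_nonneg (hm0 i)]
    exact mul_le_mul_of_nonneg_left (h.lip_grad i x hx y hy p hp q hq) (hm0 i)
  have hX2 : t * ⟪v - w, y - x⟫ = X ^ 2 := by
    rw [hX, ← real_inner_self_eq_norm_sq]
    conv_rhs => rw [e1, ← e1]
    have : x - y = -(t • (v - w)) := by rw [e1, smul_sub]; abel
    nth_rw 1 [this]
    rw [inner_neg_left, ← inner_neg_right, neg_sub, inner_smul_left]
    simp
  have hSb : κ * (t * S) ≤ X + 1 / 8 * (X + D) := by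
    have h1 := h.indep J ⟨x, hx, p, hp, hxJ, hind⟩ x hx p hp (fun i => lam i - μ i)
      (fun i hi => by simp [hlJ i hi, hmJ i hi])
    have h2 : ∑ i, (lam i - μ i) • g i x p = (v - w) - ∑ i, μ i • (g i x p - g i y q) := by
      rw [hvw]; abel
    rw [h2] at h1
    have h3 := h1.trans (norm_sub_le _ _)
    have h4 : t * ‖v - w‖ = X := by
      rw [hX, e1, ← smul_sub, norm_smul, Real.norm_of_nonneg ht.le, norm_sub_rev]
    have h5 : κ * S ≤ ‖v - w‖ + R * (L * (X + D)) := h3.trans (by linarith)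
    nlinarith [mul_le_mul_of_nonneg_left h5 ht.le,
      mul_le_mul_of_nonneg_right htR (add_nonneg hX0 hD0)]
  have hin : ⟪v - w, y - x⟫ ≤ S * (M * D + L * X ^ 2) + R * (L * (X + D)) * X := by
    rw [hvw, inner_add_left]
    refine add_le_add ?_ ?_
    · rw [sum_inner, hS, Finset.sum_mul]
      refine Finset.sum_le_sum fun i _ => ?_
      by_cases hi : i ∈ J
      · rw [inner_smul_left]
        simp only [conj_trivial]
        refine (le_abs_self _).trans ?_
        rw [abs_mul]
        refine mul_le_mul_of_nonneg_left ?_ (abs_nonneg _)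
        have h1 := abs_le.1 (h.taylor i p hp x hx y hy)
        have h2 := abs_le.1 (h.lip_param i y hy p hp q hq)
        rw [norm_sub_rev y x] at h1
        rw [hxJ i hi] at h1
        rw [hyJ i hi] at h2
        rw [abs_le]
        constructor <;> linarith [h1.1, h1.2, h2.1, h2.2]
      · simp [hlJ i hi, hmJ i hi]
    · refine (real_inner_le_norm _ _).trans ?_
      rw [norm_sub_rev y x]
      exact mul_le_mul_of_nonneg_right hN hX0
  rcases le_total X D with hXD | hXD
  · have : 0 ≤ 2 * M / κ := by positivity
    nlinarith [mul_nonneg this hD0]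
  have hmain : X ^ 2 ≤ t * S * (M * D) + 3 / 8 * X ^ 2 + 1 / 8 * D * X := by
    have h1 := mul_le_mul_of_nonneg_left hin ht.le
    rw [hX2] at h1
    have h2 : t * S * L * X ^ 2 ≤ 2 / 8 * X ^ 2 := by
      refine mul_le_mul_of_nonneg_right ?_ (sq_nonneg _)
      nlinarith [mul_le_mul_of_nonneg_left hSR (mul_nonneg ht.le hL.le)]
    have h3 := mul_le_mul_of_nonneg_right htR (mul_nonneg (add_nonneg hX0 hD0) hX0)
    nlinarith
  have hmain' : κ * X ^ 2 ≤ (10 / 8 * X) * (M * D) + κ * (3 / 8 * X ^ 2 + 1 / 8 * D * X) := by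
    have h1 := mul_le_mul_of_nonneg_left hmain hκ.le
    have h2 : κ * (t * S) ≤ 10 / 8 * X := by linarith
    have h3 := mul_le_mul_of_nonneg_right h2 (mul_nonneg hM.le hD0)
    nlinarith
  rcases hX0.eq_or_lt with h0 | hXpos
  · rw [← h0]; positivity
  have hfin : κ * (5 / 8 * X) ≤ 10 / 8 * (M * D) + κ * (1 / 8 * D) := by
    refine le_of_mul_le_mul_right ?_ hXpos
    nlinarith
  rw [div_add_one hκ.ne', div_mul_eq_mul_div, le_div_iff₀ hκ]
  nlinarith [mul_nonneg hκ.le hD0]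
lemma continuousAt_grad (h : ConstraintBounds φ g xb pb d r M L κ) {x : E} {p : F}
    (hx : x ∈ ball xb r) (hp : p ∈ ball pb r) (i : ι) : ContinuousAt (fun y => g i y p) x := by
  rw [ContinuousAt, tendsto_iff_norm_sub_tendsto_zero]
  have hlim : Tendsto (fun y : E => L * ‖y - x‖) (𝓝 x) (𝓝 0) := by
    have : ContinuousAt (fun y : E => L * ‖y - x‖) x := by fun_prop
    simpa [ContinuousAt] using this
  refine squeeze_zero' (Eventually.of_forall fun _ => norm_nonneg _) ?_ hlim
  filter_upwards [isOpen_ball.mem_nhds hx] with y hy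
  simpa using h.lip_grad i y hy x hx p hp p hp

lemma continuousAt_constraint (h : ConstraintBounds φ g xb pb d r M L κ) {x : E} {p : F}
    (hx : x ∈ ball xb r) (hp : p ∈ ball pb r) (i : ι) : ContinuousAt (fun y => φ i y p) x := by
  rw [ContinuousAt, tendsto_iff_norm_sub_tendsto_zero]
  have hlim : Tendsto (fun y : E => ‖g i x p‖ * ‖y - x‖ + L * ‖y - x‖ ^ 2) (𝓝 x) (𝓝 0) := by
    have : ContinuousAt (fun y : E => ‖g i x p‖ * ‖y - x‖ + L * ‖y - x‖ ^ 2) x := by fun_prop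
    simpa [ContinuousAt] using this
  refine squeeze_zero' (Eventually.of_forall fun _ => norm_nonneg _) ?_ hlim
  filter_upwards [isOpen_ball.mem_nhds hx] with y hy
  have h1 := abs_le.1 (h.taylor i p hp x hx y hy)
  have h2 := abs_le.1 (abs_real_inner_le_norm (g i x p) (y - x))
  rw [Real.norm_eq_abs, abs_le]
  constructor <;> linarith [h1.1, h1.2, h2.1, h2.2]

/-- Closedness of the graph of the multiplier cone. -/
lemma mem_multCone_of_tendsto (h : ConstraintBounds φ g xb pb d r M L κ) {x v : E} {p : F}
    {xs vs : ℕ → E} (hx : x ∈ ball xb r) (hp : p ∈ ball pb r) (hxs : Tendsto xs atTop (𝓝 x))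
    (hvs : Tendsto vs atTop (𝓝 v)) (hmem : ∀ᶠ k in atTop, vs k ∈ multCone φ g (xs k) p) :
    v ∈ multCone φ g x p := by
  have hex : ∀ k, ∃ lam : ι → ℝ, vs k ∈ multCone φ g (xs k) p → (∀ i, 0 ≤ lam i) ∧
      (∀ i, lam i * φ i (xs k) p = 0) ∧ vs k = ∑ i, lam i • g i (xs k) p := by
    intro k
    by_cases hk : vs k ∈ multCone φ g (xs k) p
    · obtain ⟨lam, hl⟩ := hk
      exact ⟨lam, fun _ => hl⟩
    · exact ⟨0, fun hk' => absurd hk' hk⟩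
  choose lam hlam using hex
  have hbd : ∀ᶠ k in atTop, lam k ∈ closedBall (0 : ι → ℝ) ((‖v‖ + 1) * ‖d‖) := by
    filter_upwards [hmem, hxs.eventually (isOpen_ball.mem_nhds hx),
      hvs.norm.eventually (gt_mem_nhds (lt_add_one ‖v‖))] with k hk hxk hvk
    obtain ⟨h0, hc, hv⟩ := hlam k hk
    have hs := h.sum_mult_le hxk hp h0 hc
    rw [← hv] at hs
    rw [mem_closedBall_zero_iff, pi_norm_le_iff_of_nonneg (by positivity)]
    intro i
    rw [Real.norm_of_nonneg (h0 i)]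
    calc lam k i ≤ ∑ j, lam k j := Finset.single_le_sum (fun j _ => h0 j) (Finset.mem_univ i)
      _ ≤ ‖vs k‖ * ‖d‖ := hs
      _ ≤ (‖v‖ + 1) * ‖d‖ := mul_le_mul_of_nonneg_right hvk.le (norm_nonneg _)
  obtain ⟨mu, -, ψ, hψ, hlim⟩ := (isCompact_closedBall _ _).tendsto_subseq' hbd.frequently
  have hxψ : Tendsto (xs ∘ ψ) atTop (𝓝 x) := hxs.comp hψ.tendsto_atTop
  have hmemψ := hψ.tendsto_atTop.eventually hmem
  have hlimi : ∀ i, Tendsto (fun k => lam (ψ k) i) atTop (𝓝 (mu i)) :=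
    fun i => (tendsto_pi_nhds.1 hlim) i
  refine ⟨mu, fun i => ?_, fun i => ?_, ?_⟩
  · refine ge_of_tendsto (hlimi i) ?_
    filter_upwards [hmemψ] with k hk using (hlam _ hk).1 i
  · refine tendsto_nhds_unique ((hlimi i).mul ((h.continuousAt_constraint hx hp i).tendsto.comp hxψ))
      (tendsto_const_nhds.congr' ?_)
    filter_upwards [hmemψ] with k hk using ((hlam _ hk).2.1 i).symm
  · refine tendsto_nhds_unique (hvs.comp hψ.tendsto_atTop) (Tendsto.congr' ?_
      (tendsto_finsetSum _ fun i _ =>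
        (hlimi i).smul ((h.continuousAt_grad hx hp i).tendsto.comp hxψ)))
    filter_upwards [hmemψ] with k hk using (hlam _ hk).2.2.symm

lemma regNC_subset_multCone [CompleteSpace E] (h : ConstraintBounds φ g xb pb d r M L κ) {x v : E}
    {p : F} (hx : x ∈ ball xb r) (hp : p ∈ ball pb r) (hxp : ∀ i, φ i x p ≤ 0)
    (hv : v ∈ regNC {y | ∀ i, φ i y p ≤ 0} x) : v ∈ multCone φ g x p := by
  classical
  by_contra hcon
  let K : ProperCone ℝ E :=
    { carrier := multCone φ g x p
      add_mem' := by
        rintro a b ⟨la, ha0, hac, rfl⟩ ⟨lb, hb0, hbc, rfl⟩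
        refine ⟨fun i => la i + lb i, fun i => add_nonneg (ha0 i) (hb0 i), fun i => ?_, ?_⟩
        · rw [add_mul, hac, hbc, add_zero]
        · simp [add_smul, Finset.sum_add_distrib]
      zero_mem' := ⟨0, fun _ => le_rfl, fun _ => by simp, by simp⟩
      smul_mem' := by
        rintro c a ⟨la, ha0, hac, rfl⟩
        refine ⟨fun i => c * la i, fun i => mul_nonneg c.2 (ha0 i), fun i => ?_, ?_⟩
        · rw [mul_assoc, hac, mul_zero]
        · rw [Finset.smul_sum]
          exact Finset.sum_congr rfl fun i _ => by rw [mul_smul]; rfl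
      isClosed' := by
        refine IsSeqClosed.isClosed fun vs w hvs hw => ?_
        exact h.mem_multCone_of_tendsto hx hp tendsto_const_nhds hw (Eventually.of_forall hvs) }
  obtain ⟨y, hy, hvy⟩ := K.hyperplane_separation' (x₀ := v) hcon
  have hgK : ∀ i, φ i x p = 0 → 0 ≤ ⟪g i x p, y⟫ := by
    intro i hi
    refine hy _ ⟨Pi.single i 1, fun j => ?_, fun j => ?_, ?_⟩
    · by_cases hj : j = i
      · subst hj; simp
      · simp [hj]
    · by_cases hj : j = i
      · subst hj; simp [hi]
      · simp [hj]
    · rw [Finset.sum_eq_single i (fun j _ hj => by simp [hj]) (by simp)]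
      simp
  obtain ⟨ε, hε, hεv⟩ : ∃ ε : ℝ, 0 < ε ∧ 0 < ⟪v, -y + ε • d⟫ := by
    have hcont : ContinuousAt (fun ε : ℝ => ⟪v, -y + ε • d⟫) 0 := by fun_prop
    have h0 : 0 < ⟪v, -y + (0 : ℝ) • d⟫ := by simpa using hvy
    have := (hcont.eventually (lt_mem_nhds h0)).filter_mono (nhdsWithin_le_nhds (s := Ioi 0))
    obtain ⟨ε, h1, h2⟩ := (this.and self_mem_nhdsWithin).exists
    exact ⟨ε, h2, h1⟩
  set u := -y + ε • d with hu
  have hgu : ∀ i, φ i x p = 0 → ⟪g i x p, u⟫ ≤ -ε := by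
    intro i hi
    rw [hu, inner_add_right, inner_neg_right, inner_smul_right]
    rcases h.descent i with hd | hd
    · exact absurd hi (hd x hx p hp).ne
    · nlinarith [hgK i hi, hd x hx p hp]
  have hpath : ContinuousAt (fun τ : ℝ => x + τ • u) 0 := by fun_prop
  have hpath' : Tendsto (fun τ : ℝ => x + τ • u) (𝓝[>] 0) (𝓝 x) := by
    have := hpath.tendsto.mono_left (nhdsWithin_le_nhds (s := Ioi (0 : ℝ)))
    simpa using this
  have hfeas : ∀ᶠ τ : ℝ in 𝓝[>] 0, ∀ i, φ i (x + τ • u) p ≤ 0 := by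
    rw [eventually_all]
    intro i
    rcases (hxp i).lt_or_eq with hi | hi
    · filter_upwards [hpath'.eventually
        ((h.continuousAt_constraint hx hp i).eventually (gt_mem_nhds hi))] with τ hτ using hτ.le
    · have hcont : ContinuousAt (fun τ : ℝ => L * (τ * ‖u‖ ^ 2)) 0 := by fun_prop
      have hsmall := (hcont.eventually (gt_mem_nhds (by simpa using hε))).filter_mono
        (nhdsWithin_le_nhds (s := Ioi (0 : ℝ)))
      filter_upwards [hpath'.eventually (isOpen_ball.mem_nhds hx), hsmall, self_mem_nhdsWithin]
        with τ hτ hτs hτ0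
      have h1 := (abs_le.1 (h.taylor i p hp x hx _ hτ)).2
      have hτ0' : 0 < τ := hτ0
      rw [add_sub_cancel_left, inner_smul_right, norm_smul, Real.norm_of_nonneg hτ0'.le, hi] at h1
      nlinarith [mul_le_mul_of_nonneg_left (hgu i hi) hτ0'.le]
  set η := ⟪v, u⟫ / (2 * (‖u‖ + 1)) with hη
  have hη0 : 0 < η := by positivity
  have hreg := hv η hη0
  have hten : Tendsto (fun τ : ℝ => x + τ • u) (𝓝[>] 0) (𝓝[{y | ∀ i, φ i y p ≤ 0}] x) :=
    tendsto_nhdsWithin_iff.2 ⟨hpath', hfeas⟩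
  obtain ⟨τ, hτ, hτ0⟩ := ((hten.eventually hreg).and self_mem_nhdsWithin).exists
  have hτ0' : 0 < τ := hτ0
  rw [add_sub_cancel_left, inner_smul_right, norm_smul, Real.norm_of_nonneg hτ0'.le] at hτ
  have h2 : ⟪v, u⟫ ≤ η * ‖u‖ := by
    refine le_of_mul_le_mul_left ?_ hτ0'
    linarith
  have h3 : η * (2 * (‖u‖ + 1)) = ⟪v, u⟫ := by
    rw [hη]; field_simp
  nlinarith [norm_nonneg u]

lemma mem_and_mem_multCone_of_mem_limNC [CompleteSpace E]
    (h : ConstraintBounds φ g xb pb d r M L κ) {x v : E}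
    {p : F} (hx : x ∈ ball xb r) (hp : p ∈ ball pb r)
    (hv : v ∈ limNC {y | ∀ i, φ i y p ≤ 0} x) : (∀ i, φ i x p ≤ 0) ∧ v ∈ multCone φ g x p := by
  obtain ⟨xs, vs, hxs, hlim, hvs, hvlim⟩ := hv
  refine ⟨fun i => ?_, ?_⟩
  · exact le_of_tendsto ((h.continuousAt_constraint hx hp i).tendsto.comp hlim)
      (Eventually.of_forall fun k => hxs k i)
  · refine h.mem_multCone_of_tendsto hx hp hlim hvlim ?_
    filter_upwards [hlim.eventually (isOpen_ball.mem_nhds hx)] with k hk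
    exact h.regNC_subset_multCone hk hp (hxs k) (hvs k)

/-- Existence of local projections onto perturbed feasible sets. -/
lemma exists_regNC_of_perturbation [ProperSpace E] (h : ConstraintBounds φ g xb pb d r M L κ)
    {x v : E} {p q : F} {t R ρ s : ℝ} (hx : x ∈ ball xb (r / 2)) (hp : p ∈ ball pb r)
    (hq : q ∈ ball pb r) (hxp : ∀ i, φ i x p ≤ 0) (hv : v ∈ multCone φ g x p)
    (hvR : ‖v‖ * ‖d‖ ≤ R) (ht : 0 < t) (htR : t * R * L ≤ 1 / 8) (hρ : 0 < ρ) (hρr : ρ ≤ r / 2)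
    (hs0 : 0 ≤ s) (hs : 2 * M * ‖p - q‖ ≤ s) (hs1 : L * s * ‖d‖ ^ 2 ≤ 1 / 2) (hs2 : s * ‖d‖ ≤ ρ)
    (hs3 : s ^ 2 * ‖d‖ ^ 2 + 3 * s * t * R < 3 / 4 * ρ ^ 2) :
    ∃ y, ‖y - x‖ < ρ ∧ (∀ i, φ i y q ≤ 0) ∧
      t⁻¹ • (x + t • v - y) ∈ regNC {y | ∀ i, φ i y q ≤ 0} y := by
  have hR : 0 ≤ R := le_trans (by positivity) hvR
  have hsub : closedBall x ρ ⊆ ball xb r := by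
    intro y hy
    rw [mem_closedBall] at hy
    rw [mem_ball] at hx ⊢
    linarith [dist_triangle y x xb]
  have hxr : x ∈ ball xb r := hsub (mem_closedBall_self hρ.le)
  set z := x + t • v with hz
  set A := closedBall x ρ ∩ {y | ∀ i, φ i y q ≤ 0} with hA
  have hcontφ : ∀ i, ContinuousOn (fun y => φ i y q) (closedBall x ρ) := fun i y hy =>
    (h.continuousAt_constraint (hsub hy) hq i).continuousWithinAt
  have hAcomp : IsCompact A := by
    refine (isCompact_closedBall x ρ).of_isClosed_subset ?_ inter_subset_left
    have : A = closedBall x ρ ∩ ⋂ i, (closedBall x ρ ∩ (fun y => φ i y q) ⁻¹' Iic 0) := by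
      ext y
      simp only [hA, mem_inter_iff, mem_ofPred_eq, mem_iInter, mem_preimage, mem_Iic]
      exact ⟨fun hy => ⟨hy.1, fun i => ⟨hy.1, hy.2 i⟩⟩, fun hy => ⟨hy.1, fun i => (hy.2 i).2⟩⟩
    rw [this]
    exact isClosed_closedBall.inter (isClosed_iInter fun i =>
      (hcontφ i).preimage_isClosed_of_isClosed isClosed_closedBall isClosed_Iic)
  have hfeas : x + s • d ∈ A := by
    have hmem : x + s • d ∈ closedBall x ρ := by
      rw [mem_closedBall, dist_eq_norm, add_sub_cancel_left, norm_smul, Real.norm_of_nonneg hs0]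
      exact hs2
    refine ⟨hmem, fun i => ?_⟩
    rcases h.descent i with hd | hd
    · exact (hd _ (hsub hmem) q hq).le
    · have h1 := (abs_le.1 (h.taylor i q hq x hxr _ (hsub hmem))).2
      have h2 := (abs_le.1 (h.lip_param i x hxr p hp q hq)).1
      rw [add_sub_cancel_left, inner_smul_right, norm_smul, Real.norm_of_nonneg hs0] at h1
      have h3 := hd x hxr q hq
      nlinarith [hxp i, mul_le_mul_of_nonneg_left h3 hs0, mul_le_mul_of_nonneg_left hs1 hs0]
  obtain ⟨y, hyA, hymin⟩ := hAcomp.exists_isMinOn ⟨_, hfeas⟩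
    (f := fun y => ‖y - z‖) (by fun_prop)
  have hyx : ‖y - x‖ < ρ := by
    have h1 : ‖y - z‖ ≤ ‖x + s • d - z‖ := hymin hfeas
    have h2 : ‖y - z‖ ^ 2 ≤ ‖x + s • d - z‖ ^ 2 := pow_le_pow_left₀ (norm_nonneg _) h1 2
    have e1 : y - z = (y - x) - t • v := by rw [hz]; abel
    have e2 : x + s • d - z = s • d - t • v := by rw [hz]; abel
    rw [e1, e2, norm_sub_sq_real (y - x), norm_sub_sq_real (s • d), inner_smul_right, inner_smul_right,
      inner_smul_left, norm_smul s d, Real.norm_of_nonneg hs0, real_inner_comm] at h2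
    simp only [conj_trivial] at h2
    have h3 := h.inner_le_of_feasible hxr (hsub hyA.1) hp hq hv hyA.2
    have hB : 0 ≤ M * ‖p - q‖ + L * ‖y - x‖ ^ 2 := by
      have := h.M_pos; have := h.L_pos; positivity
    have h4 := h3.trans (mul_le_mul_of_nonneg_right hvR hB)
    have h5 : -⟪d, v⟫ ≤ R := by
      have := neg_le_of_abs_le (abs_real_inner_le_norm d v)
      linarith [mul_comm ‖v‖ ‖d‖]
    have h6 := mul_le_mul_of_nonneg_left h5 (mul_nonneg hs0 ht.le)
    have h7 := mul_le_mul_of_nonneg_left h4 ht.le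
    have h8 := mul_le_mul_of_nonneg_right htR (sq_nonneg ‖y - x‖)
    have h9 := mul_le_mul_of_nonneg_left hs (mul_nonneg ht.le hR)
    have h10 : ‖y - x‖ ^ 2 < ρ ^ 2 := by nlinarith
    exact lt_of_pow_lt_pow_left₀ 2 hρ.le h10
  refine ⟨y, hyx, hyA.2, fun ε hε => ?_⟩
  have hy' : y ∈ ball x ρ := by rwa [mem_ball, dist_eq_norm]
  filter_upwards [mem_nhdsWithin_of_mem_nhds (isOpen_ball.mem_nhds hy'),
    mem_nhdsWithin_of_mem_nhds (ball_mem_nhds y (show 0 < 2 * t * ε by positivity)),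
    self_mem_nhdsWithin] with u hu1 hu2 hu3
  have h1 : ‖y - z‖ ≤ ‖u - z‖ := hymin ⟨ball_subset_closedBall hu1, hu3⟩
  have h2 : ‖y - z‖ ^ 2 ≤ ‖u - z‖ ^ 2 := pow_le_pow_left₀ (norm_nonneg _) h1 2
  have e1 : u - z = (u - y) - (z - y) := by abel
  rw [e1, norm_sub_sq_real (u - y), norm_sub_rev y z, real_inner_comm] at h2
  rw [mem_ball, dist_eq_norm] at hu2
  rw [inner_smul_left]
  simp only [conj_trivial]
  rw [inv_mul_le_iff₀ ht]
  nlinarith [norm_nonneg (u - y), mul_le_mul_of_nonneg_right hu2.le (norm_nonneg (u - y))]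

variable [NormedSpace ℝ F]

/-- Lipschitz estimate for local projections onto perturbed feasible sets. -/
lemma exists_regNC_norm_sub_le [ProperSpace E] (h : ConstraintBounds φ g xb pb d r M L κ)
    {x v : E} {p q : F} {t R ρ s : ℝ} (hx : x ∈ ball xb (r / 2)) (hp : p ∈ ball pb r)
    (hq : q ∈ ball pb r) (hxp : ∀ i, φ i x p ≤ 0) (hv : v ∈ multCone φ g x p)
    (hvR : (‖v‖ + 1) * ‖d‖ ≤ R) (ht : 0 < t) (htR : t * R * L ≤ 1 / 8) (hρ : 0 < ρ)
    (hρr : ρ ≤ r / 2) (hρt : ρ ≤ t) (hs0 : 0 ≤ s) (hs : 2 * M * ‖p - q‖ ≤ s)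
    (hs1 : L * s * ‖d‖ ^ 2 ≤ 1 / 2) (hs2 : s * ‖d‖ ≤ ρ)
    (hs3 : s ^ 2 * ‖d‖ ^ 2 + 3 * s * t * R < 3 / 4 * ρ ^ 2) :
    ∃ y, ‖x - y‖ ≤ (2 * M / κ + 1) * ‖p - q‖ ∧ (∀ i, φ i y q ≤ 0) ∧
      t⁻¹ • (x + t • v - y) ∈ regNC {y | ∀ i, φ i y q ≤ 0} y := by
  classical
  have hM := h.M_pos
  have hκ := h.κ_pos
  have hvR' : ‖v‖ * ‖d‖ ≤ R := le_trans (by nlinarith [norm_nonneg d]) hvR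
  have hxr : x ∈ ball xb r := ball_subset_ball (by linarith [h.r_pos]) hx
  let path : ℝ → F := fun τ => p + τ • (q - p)
  have hpath : ∀ τ σ, ‖path τ - path σ‖ = |τ - σ| * ‖p - q‖ := by
    intro τ σ
    have : path τ - path σ = (τ - σ) • (q - p) := by
      simp only [path, sub_smul]; abel
    rw [this, norm_smul, Real.norm_eq_abs, norm_sub_rev]
  have hpath0 : path 0 = p := by simp [path]
  have hpath1 : path 1 = q := by simp [path]
  have hpr : ∀ τ ∈ Icc (0 : ℝ) 1, path τ ∈ ball pb r := fun τ hτ =>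
    (convex_ball pb r).add_smul_sub_mem hp hq hτ
  have hex : ∀ τ : ℝ, ∃ y, τ ∈ Icc (0 : ℝ) 1 → ‖y - x‖ < ρ ∧ (∀ i, φ i y (path τ) ≤ 0) ∧
      t⁻¹ • (x + t • v - y) ∈ regNC {y | ∀ i, φ i y (path τ) ≤ 0} y := by
    intro τ
    by_cases hτ : τ ∈ Icc (0 : ℝ) 1
    · have h1 : ‖p - path τ‖ ≤ ‖p - q‖ := by
        have h1 := hpath 0 τ
        rw [hpath0, zero_sub, abs_neg, abs_of_nonneg hτ.1] at h1
        rw [h1]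
        exact mul_le_of_le_one_left (norm_nonneg (p - q)) hτ.2
      obtain ⟨y, hy⟩ := h.exists_regNC_of_perturbation hx hp (hpr τ hτ) hxp hv hvR' ht htR hρ hρr
        hs0 ((mul_le_mul_of_nonneg_left h1 (mul_pos two_pos h.M_pos).le).trans hs) hs1 hs2 hs3
      exact ⟨y, fun _ => hy⟩
    · exact ⟨0, fun h' => absurd h' hτ⟩
  choose f hf using hex
  let w : ℝ → E := fun τ => t⁻¹ • (x + t • v - f τ)
  have hz : ∀ τ, f τ + t • w τ = x + t • v := by
    intro τ
    simp only [w, smul_inv_smul₀ ht.ne']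
    abel
  have hfr : ∀ τ ∈ Icc (0 : ℝ) 1, f τ ∈ ball xb r := by
    intro τ hτ
    have h1 := (hf τ hτ).1
    rw [← dist_eq_norm] at h1
    rw [mem_ball] at hx ⊢
    linarith [dist_triangle (f τ) x xb]
  have hw : ∀ τ ∈ Icc (0 : ℝ) 1, w τ ∈ multCone φ g (f τ) (path τ) := fun τ hτ =>
    h.regNC_subset_multCone (hfr τ hτ) (hpr τ hτ) (hf τ hτ).2.1 (hf τ hτ).2.2
  have hwR : ∀ τ ∈ Icc (0 : ℝ) 1, ‖w τ‖ * ‖d‖ ≤ R := by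
    intro τ hτ
    refine le_trans (mul_le_mul_of_nonneg_right ?_ (norm_nonneg d)) hvR
    have e : w τ = v + t⁻¹ • (x - f τ) := by
      simp only [w]
      rw [show x + t • v - f τ = t • v + (x - f τ) by abel, smul_add, inv_smul_smul₀ ht.ne']
    rw [e]
    refine (norm_add_le _ _).trans ?_
    rw [norm_smul, norm_inv, Real.norm_of_nonneg ht.le, norm_sub_rev]
    have : t⁻¹ * ‖f τ - x‖ ≤ 1 := by
      rw [inv_mul_le_iff₀ ht]
      linarith [(hf τ hτ).1]
    linarith
  have hR : 0 ≤ R := le_trans (by positivity) hvR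
  have hhold : ∀ τ ∈ Icc (0 : ℝ) 1, ∀ σ ∈ Icc (0 : ℝ) 1,
      ‖f τ - f σ‖ ^ 2 ≤ 4 * t * R * M * ‖p - q‖ * |τ - σ| := by
    intro τ hτ σ hσ
    have := h.sq_norm_sub_le (hfr τ hτ) (hfr σ hσ) (hpr τ hτ) (hpr σ hσ) (hw τ hτ) (hw σ hσ)
      (hf τ hτ).2.1 (hf σ hσ).2.1 (hwR τ hτ) (hwR σ hσ) ht htR ((hz τ).trans (hz σ).symm)
    rw [hpath] at this
    linarith
  have h0I : (0 : ℝ) ∈ Icc (0 : ℝ) 1 := ⟨le_rfl, zero_le_one⟩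
  have h1I : (1 : ℝ) ∈ Icc (0 : ℝ) 1 := ⟨zero_le_one, le_rfl⟩
  have hfx : f 0 = x := by
    have hv0 : v ∈ multCone φ g x (path 0) := by rwa [hpath0]
    have := h.sq_norm_sub_le (hfr 0 h0I) hxr (hpr 0 h0I) (hpr 0 h0I) (hw 0 h0I) hv0
      (hf 0 h0I).2.1 (by rwa [hpath0]) (hwR 0 h0I) hvR' ht htR (hz 0)
    rw [sub_self, norm_zero, mul_zero] at this
    exact sub_eq_zero.1 (norm_eq_zero.1 (pow_eq_zero_iff two_ne_zero |>.1
      (le_antisymm this (sq_nonneg _))))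
  have hcont : ContinuousOn f (Icc 0 1) := by
    intro τ hτ
    rw [ContinuousWithinAt, tendsto_iff_norm_sub_tendsto_zero]
    have hlim : Tendsto (fun σ => √(4 * t * R * M * ‖p - q‖ * |σ - τ|)) (𝓝[Icc 0 1] τ) (𝓝 0) := by
      have : ContinuousAt (fun σ => √(4 * t * R * M * ‖p - q‖ * |σ - τ|)) τ := by fun_prop
      have := this.tendsto.mono_left (nhdsWithin_le_nhds (s := Icc 0 1))
      simpa using this
    refine squeeze_zero' (Eventually.of_forall fun _ => norm_nonneg _) ?_ hlim
    filter_upwards [self_mem_nhdsWithin] with σ hσ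
    exact Real.le_sqrt_of_sq_le (hhold σ hσ τ hτ)
  have hJ : ∀ τ : ℝ, ∃ J : Finset ι, τ ∈ Icc (0 : ℝ) 1 → ∃ lam : ι → ℝ, (∀ i, 0 ≤ lam i) ∧
      (∀ i, i ∉ J → lam i = 0) ∧ (∀ i ∈ J, φ i (f τ) (path τ) = 0) ∧
      w τ = ∑ i, lam i • g i (f τ) (path τ) ∧
      LinearIndepOn ℝ (fun i => g i (f τ) (path τ)) (J : Set ι) := by
    intro τ
    by_cases hτ : τ ∈ Icc (0 : ℝ) 1
    · obtain ⟨J, lam, hl⟩ := exists_indep_of_mem_multCone (hw τ hτ)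
      exact ⟨J, fun _ => ⟨lam, hl⟩⟩
    · exact ⟨∅, fun h' => absurd h' hτ⟩
  choose J hJ using hJ
  have hmain : ‖f 0 - f 1‖ ≤ (2 * M / κ + 1) * ‖p - q‖ * (1 - 0) := by
    refine norm_sub_le_of_finite_pieces (c := J) Finset.univ 0 zero_le_one hcont
      (fun _ _ => Finset.mem_univ _) fun τ hτ σ hσ hJe => ?_
    obtain ⟨lam, hl0, hlJ, hlφ, hlw, hind⟩ := hJ τ hτ
    obtain ⟨μ, hm0, hmJ, hmφ, hmw, -⟩ := hJ σ hσ
    rw [← hJe] at hmJ hmφ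
    have := h.norm_sub_le_of_common_support (hfr τ hτ) (hfr σ hσ) (hpr τ hτ) (hpr σ hσ) hl0 hlJ hlφ
      hlw hind hm0 hmJ hmφ hmw (hwR τ hτ) (hwR σ hσ) ht htR ((hz τ).trans (hz σ).symm)
    rw [hpath] at this
    linarith
  have hf1 := hf 1 h1I
  rw [hpath1] at hf1
  rw [hfx, sub_zero, mul_one] at hmain
  exact ⟨f 1, hmain, hf1.2⟩

/-- Lipschitz-like property of the normal cone graphs under uniform constraint bounds. -/
lemma lipschitzLike_limNC [ProperSpace E]
    (h : ConstraintBounds φ g xb pb d r M L κ) (vh : E) :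
    LipschitzLike (fun p => {t : E × E | t.2 ∈ limNC {y | ∀ i, φ i y p ≤ 0} t.1}) pb (xb, vh) := by
  have hM := h.M_pos
  have hL := h.L_pos
  have hκ := h.κ_pos
  have hr := h.r_pos
  obtain ⟨R, hR⟩ : ∃ R, R = (‖vh‖ + 2) * ‖d‖ := ⟨_, rfl⟩
  have hR0 : 0 ≤ R := by rw [hR]; positivity
  obtain ⟨t, ht⟩ : ∃ t, t = 1 / (8 * (R * L + 1)) := ⟨_, rfl⟩
  have ht0 : 0 < t := by rw [ht]; positivity
  have htR : t * R * L ≤ 1 / 8 := by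
    rw [ht, mul_assoc, one_div_mul_eq_div, div_le_div_iff₀ (by positivity) (by positivity)]
    nlinarith
  set ρ := min (r / 2) t with hρ
  have hρ0 : 0 < ρ := by positivity
  obtain ⟨s, ⟨hs1, hs2, hs3⟩, hs0⟩ : ∃ s, (L * s * ‖d‖ ^ 2 < 1 / 2 ∧ s * ‖d‖ < ρ ∧
      s ^ 2 * ‖d‖ ^ 2 + 3 * s * t * R < 3 / 4 * ρ ^ 2) ∧ 0 < s := by
    have h1 : ContinuousAt (fun s : ℝ => L * s * ‖d‖ ^ 2) 0 := by fun_prop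
    have h2 : ContinuousAt (fun s : ℝ => s * ‖d‖) 0 := by fun_prop
    have h3 : ContinuousAt (fun s : ℝ => s ^ 2 * ‖d‖ ^ 2 + 3 * s * t * R) 0 := by fun_prop
    have h4 := ((h1.tendsto.eventually_lt_const (u := 1 / 2) (by simp)).and
      ((h2.tendsto.eventually_lt_const (u := ρ) (by simpa)).and
      (h3.tendsto.eventually_lt_const (u := 3 / 4 * ρ ^ 2) (by simpa using pow_pos hρ0 2)))).filter_mono
      (nhdsWithin_le_nhds (s := Ioi (0 : ℝ)))
    exact (h4.and self_mem_nhdsWithin).exists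
  set K := 2 * M / κ + 1 with hK
  have hK0 : 0 < K := by positivity
  refine ⟨(1 + t⁻¹) * K, by positivity, ball pb (min r (s / (4 * M))),
    ball_mem_nhds _ (by positivity), ball xb (r / 2) ×ˢ ball vh 1,
    prod_mem_nhds (ball_mem_nhds _ (by positivity)) (ball_mem_nhds _ one_pos), ?_⟩
  rintro p hp q hq ⟨x, v⟩ ⟨hv, hx, hvb⟩
  simp only at hx hvb
  have hpr : p ∈ ball pb r := ball_subset_ball (min_le_left _ _) hp
  have hqr : q ∈ ball pb r := ball_subset_ball (min_le_left _ _) hq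
  have hxr : x ∈ ball xb r := ball_subset_ball (by linarith) hx
  obtain ⟨hxp, hvc⟩ := h.mem_and_mem_multCone_of_mem_limNC hxr hpr hv
  have hvR : (‖v‖ + 1) * ‖d‖ ≤ R := by
    rw [hR]
    refine mul_le_mul_of_nonneg_right ?_ (norm_nonneg _)
    rw [mem_ball, dist_eq_norm] at hvb
    linarith [norm_sub_norm_le v vh]
  have hspq : 2 * M * ‖p - q‖ ≤ s := by
    have h1 : dist p pb < s / (4 * M) := (mem_ball.1 hp).trans_le (min_le_right _ _)
    have h2 : dist q pb < s / (4 * M) := (mem_ball.1 hq).trans_le (min_le_right _ _)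
    have h3 : ‖p - q‖ ≤ 2 * (s / (4 * M)) := by
      rw [← dist_eq_norm]
      linarith [dist_triangle_right p q pb]
    calc 2 * M * ‖p - q‖ ≤ 2 * M * (2 * (s / (4 * M))) := by gcongr
      _ = s := by field_simp; norm_num
  obtain ⟨y, hxy, hyq, hn⟩ := h.exists_regNC_norm_sub_le hx hpr hqr hxp hvc hvR ht0 htR hρ0
    (min_le_left _ _) (min_le_right _ _) hs0.le hspq hs1.le hs2.le hs3
  refine ⟨(y, t⁻¹ • (x + t • v - y)), ⟨fun _ => y, fun _ => t⁻¹ • (x + t • v - y), fun _ => hyq,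
    tendsto_const_nhds, fun _ => hn, tendsto_const_nhds⟩, ?_⟩
  have e : v - t⁻¹ • (x + t • v - y) = -(t⁻¹ • (x - y)) := by
    rw [show x + t • v - y = t • v + (x - y) by abel, smul_add, inv_smul_smul₀ ht0.ne']
    abel
  rw [Prod.mk_sub_mk, e, Prod.norm_mk, norm_neg, norm_smul, norm_inv, Real.norm_of_nonneg ht0.le,
    dist_eq_norm]
  have ht' : 0 < t⁻¹ := by positivity
  have hfin : (1 + t⁻¹) * ‖x - y‖ ≤ (1 + t⁻¹) * K * ‖p - q‖ := by
    rw [mul_assoc]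
    exact mul_le_mul_of_nonneg_left hxy (by positivity)
  refine le_trans (max_le ?_ ?_) hfin
  · nlinarith [mul_nonneg ht'.le (norm_nonneg (x - y))]
  · nlinarith [norm_nonneg (x - y)]


end ConstraintBounds

/-- A family that is linearly independent at a point satisfies a uniform lower bound nearby. -/
lemma exists_sum_abs_le_norm_sum {T : Type*} [TopologicalSpace T] {G : ι → T → E} {t₀ : T}
    (hG : ∀ i, ContinuousAt (G i) t₀) {J : Finset ι}
    (hJ : LinearIndepOn ℝ (fun i => G i t₀) (J : Set ι)) :
    ∃ κ > 0, ∀ᶠ t in 𝓝 t₀, ∀ μ : ι → ℝ, (∀ i, i ∉ J → μ i = 0) →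
      κ * ∑ i, |μ i| ≤ ‖∑ i, μ i • G i t‖ := by
  classical
  have hli : LinearIndependent ℝ (fun i : J => G i t₀) := hJ
  obtain ⟨K, hK, hanti⟩ := LinearMap.exists_antilipschitzWith
    (Fintype.linearCombination ℝ (fun i : J => G i t₀))
    (LinearMap.ker_eq_bot.2 hli.fintypeLinearCombination_injective)
  have hK' : (0 : ℝ) < K := hK
  set c : ℝ := 1 / (K * (J.card + 1)) with hc
  have hc0 : 0 < c := by positivity
  have hsum : ∀ (μ : ι → ℝ), (∀ i, i ∉ J → μ i = 0) → c * ∑ i, |μ i| ≤ ‖∑ i, μ i • G i t₀‖ := by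
    intro μ hμ
    have h1 := hanti.le_mul_dist (fun i : J => μ i) 0
    rw [map_zero, dist_zero_right, dist_zero_right, Fintype.linearCombination_apply,
      Finset.sum_coe_sort J (fun i => μ i • G i t₀),
      Finset.sum_subset (Finset.subset_univ J) (fun i _ hi => by rw [hμ i hi, zero_smul])] at h1
    have h2 : ∑ i, |μ i| ≤ J.card * ‖fun i : J => μ i‖ := by
      rw [← Finset.sum_subset (Finset.subset_univ J) (fun i _ hi => by rw [hμ i hi, abs_zero]),
        ← nsmul_eq_mul]
      exact Finset.sum_le_card_nsmul _ _ _ fun i hi => norm_le_pi_norm (fun i : J => μ i) ⟨i, hi⟩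
    rw [hc, one_div_mul_eq_div, div_le_iff₀ (by positivity)]
    have h3 := norm_nonneg (fun i : J => μ i)
    nlinarith [mul_le_mul_of_nonneg_left h1 (Nat.cast_nonneg (α := ℝ) J.card),
      norm_nonneg (∑ i, μ i • G i t₀)]
  refine ⟨c / 2, by positivity, ?_⟩
  have hev : ∀ᶠ t in 𝓝 t₀, ∀ i, ‖G i t - G i t₀‖ < c / 2 :=
    eventually_all.2 fun i => by
      simpa [dist_eq_norm] using (hG i).eventually (ball_mem_nhds _ (half_pos hc0))
  filter_upwards [hev] with t ht μ hμ
  have h1 := hsum μ hμ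
  have h2 : ‖∑ i, μ i • G i t₀ - ∑ i, μ i • G i t‖ ≤ c / 2 * ∑ i, |μ i| := by
    rw [← Finset.sum_sub_distrib, Finset.mul_sum]
    refine (norm_sum_le _ _).trans (Finset.sum_le_sum fun i _ => ?_)
    rw [← smul_sub, norm_smul, Real.norm_eq_abs, norm_sub_rev, mul_comm]
    exact mul_le_mul_of_nonneg_right (ht i).le (abs_nonneg _)
  have h3 := norm_sub_norm_le (∑ i, μ i • G i t₀) (∑ i, μ i • G i t)
  linarith

/-- Linear independence on a finite set only depends on the rank of the family. -/
lemma linearIndepOn_of_finrank_span_eq {κ : Type*} {a b : κ → E} {J : Finset κ}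
    (ha : LinearIndepOn ℝ a (J : Set κ))
    (hab : Module.finrank ℝ (Submodule.span ℝ (a '' (J : Set κ))) =
      Module.finrank ℝ (Submodule.span ℝ (b '' (J : Set κ)))) :
    LinearIndepOn ℝ b (J : Set κ) := by
  rw [Set.image_eq_range, Set.image_eq_range] at hab
  have ha' := linearIndependent_iff_card_eq_finrank_span.1
    (show LinearIndependent ℝ (fun i : (J : Set κ) => a i) from ha)
  exact linearIndependent_iff_card_eq_finrank_span.2 (ha'.trans hab)

/-- Local Lipschitz and second-order bounds for a twice continuously differentiable
parametric function and its partial gradient. -/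
lemma exists_gradient_bounds [NormedSpace ℝ F] [CompleteSpace E] {f : E → F → ℝ} {xb : E} {pb : F}
    (hf : ContDiffAt ℝ 2 (fun t : E × F => f t.1 t.2) (xb, pb)) :
    ∃ r > 0, ∃ K > 0,
      (∀ x ∈ ball xb r, ∀ p ∈ ball pb r, ∀ q ∈ ball pb r, |f x p - f x q| ≤ K * ‖p - q‖) ∧
      (∀ p ∈ ball pb r, ∀ x ∈ ball xb r, ∀ y ∈ ball xb r,
        |f y p - f x p - ⟪gradient (fun z => f z p) x, y - x⟫| ≤ K * ‖y - x‖ ^ 2) ∧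
      (∀ x ∈ ball xb r, ∀ y ∈ ball xb r, ∀ p ∈ ball pb r, ∀ q ∈ ball pb r,
        ‖gradient (fun z => f z p) x - gradient (fun z => f z q) y‖ ≤
          K * (‖x - y‖ + ‖p - q‖)) := by
  obtain ⟨K₁, s₁, hs₁, hK₁⟩ := (hf.of_le one_le_two).exists_lipschitzOnWith
  obtain ⟨K₂, s₂, hs₂, hK₂⟩ :=
    (hf.fderiv_right (m := 1) (by norm_num [one_add_one_eq_two])).exists_lipschitzOnWith
  have hdiff : ∀ᶠ t in 𝓝 (xb, pb), DifferentiableAt ℝ (fun t : E × F => f t.1 t.2) t :=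
    ((hf.of_le one_le_two).eventually (by simp)).mono fun t ht => ht.differentiableAt one_ne_zero
  obtain ⟨r, hr, hrs⟩ := Metric.mem_nhds_iff.1 (inter_mem (inter_mem hs₁ hs₂) hdiff)
  have hmem : ∀ {x p}, x ∈ ball xb r → p ∈ ball pb r → (x, p) ∈ ball (xb, pb) r := by
    intro x p hx hp
    rw [← ball_prod_same]
    exact ⟨hx, hp⟩
  let D : E → F → (E →L[ℝ] ℝ) := fun x p =>
    (fderiv ℝ (fun t : E × F => f t.1 t.2) (x, p)).comp (ContinuousLinearMap.inl ℝ E F)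
  have hD : ∀ x ∈ ball xb r, ∀ p ∈ ball pb r, HasFDerivAt (fun z => f z p) (D x p) x := by
    intro x hx p hp
    have h1 : HasFDerivAt (fun t : E × F => f t.1 t.2) _ (x, p) :=
      (hrs (hmem hx hp)).2.hasFDerivAt
    exact HasFDerivAt.comp (f := fun z : E => (z, p)) x h1 (hasFDerivAt_prodMk_left x p)
  have hgrad : ∀ x ∈ ball xb r, ∀ p ∈ ball pb r,
      gradient (fun z => f z p) x = (InnerProductSpace.toDual ℝ E).symm (D x p) := by
    intro x hx p hp
    rw [gradient, (hD x hx p hp).fderiv]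
  have hDlip : ∀ x ∈ ball xb r, ∀ y ∈ ball xb r, ∀ p ∈ ball pb r, ∀ q ∈ ball pb r,
      ‖D x p - D y q‖ ≤ K₂ * (‖x - y‖ + ‖p - q‖) := by
    intro x hx y hy p hp q hq
    have h1 := hK₂.norm_sub_le (hrs (hmem hx hp)).1.2 (hrs (hmem hy hq)).1.2
    have h2 : D x p - D y q = (fderiv ℝ (fun t : E × F => f t.1 t.2) (x, p) -
      fderiv ℝ (fun t : E × F => f t.1 t.2) (y, q)).comp (ContinuousLinearMap.inl ℝ E F) := by
      simp only [D, ContinuousLinearMap.sub_comp]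
    rw [h2]
    refine (ContinuousLinearMap.opNorm_comp_le _ _).trans ?_
    refine (mul_le_of_le_one_right (norm_nonneg _)
      (ContinuousLinearMap.norm_inl_le_one ℝ E F)).trans (h1.trans ?_)
    gcongr
    rw [Prod.norm_def]
    exact max_le_add_of_nonneg (norm_nonneg _) (norm_nonneg _)
  refine ⟨r, hr, K₁ + K₂ + 1, by positivity, ?_, ?_, ?_⟩
  · intro x hx p hp q hq
    have h1 := hK₁.norm_sub_le (hrs (hmem hx hp)).1.1 (hrs (hmem hx hq)).1.1
    rw [Prod.norm_def] at h1
    simp only [Prod.fst_sub, Prod.snd_sub, sub_self, norm_zero, Real.norm_eq_abs,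
      max_eq_right (norm_nonneg (p - q))] at h1
    refine h1.trans (mul_le_mul_of_nonneg_right ?_ (norm_nonneg _))
    linarith [K₂.coe_nonneg]
  · intro p hp x hx y hy
    have hseg : segment ℝ x y ⊆ ball xb r := (convex_ball xb r).segment_subset hx hy
    have h1 := (convex_segment x y).norm_image_sub_le_of_norm_hasFDerivWithin_le'
      (f := fun z => f z p) (f' := fun z => D z p) (φ := D x p) (C := K₂ * ‖y - x‖)
      (fun z hz => (hD z (hseg hz) p hp).hasFDerivWithinAt)
      (fun z hz => by
        refine (hDlip z (hseg hz) x hx p hp p hp).trans ?_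
        rw [sub_self, norm_zero, add_zero]
        gcongr
        obtain ⟨θ, hθ, rfl⟩ := (segment_eq_image' ℝ x y ▸ hz :)
        rw [add_sub_cancel_left, norm_smul, Real.norm_of_nonneg hθ.1]
        exact mul_le_of_le_one_left (norm_nonneg _) hθ.2)
      (left_mem_segment ℝ x y) (right_mem_segment ℝ x y)
    rw [hgrad x hx p hp, InnerProductSpace.toDual_symm_apply]
    rw [Real.norm_eq_abs] at h1
    refine h1.trans ?_
    rw [mul_assoc, ← sq]
    refine mul_le_mul_of_nonneg_right ?_ (sq_nonneg _)
    linarith [K₁.coe_nonneg]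
  · intro x hx y hy p hp q hq
    rw [hgrad x hx p hp, hgrad y hy q hq, ← map_sub, LinearIsometryEquiv.norm_map]
    refine (hDlip x hx y hy p hp q hq).trans (mul_le_mul_of_nonneg_right ?_ (by positivity))
    linarith [K₁.coe_nonneg]

/-- Partial MFCQ and CRCQ for twice continuously differentiable constraints yield uniform
constraint bounds near the reference point. -/
theorem exists_constraintBounds [NormedSpace ℝ F] [CompleteSpace E]
    {φ : ι → E → F → ℝ} {xb : E} {pb : F}
    (hsmooth : ∀ i, ContDiffAt ℝ 2 (fun t : E × F => φ i t.1 t.2) (xb, pb))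
    (hxb : ∀ i, φ i xb pb ≤ 0)
    (hMFCQ : ∃ d : E, ∀ i, φ i xb pb = 0 → ⟪gradient (fun y => φ i y pb) xb, d⟫ < 0)
    (hCRCQ : ∃ W ∈ 𝓝 (xb, pb), ∀ J : Finset ι, (∀ i ∈ J, φ i xb pb = 0) →
      ∀ t₁ ∈ W, ∀ t₂ ∈ W,
        Module.finrank ℝ ↥(Submodule.span ℝ
            ((fun i => gradient (fun y => φ i y t₁.2) t₁.1) '' (J : Set ι)))
          = Module.finrank ℝ ↥(Submodule.span ℝ
            ((fun i => gradient (fun y => φ i y t₂.2) t₂.1) '' (J : Set ι)))) :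
    ∃ d r M L κ,
      ConstraintBounds φ (fun i x p => gradient (fun y => φ i y p) x) xb pb d r M L κ := by
  classical
  obtain ⟨d₀, hd₀⟩ := hMFCQ
  obtain ⟨W, hW, hrank⟩ := hCRCQ
  choose r₀ hr₀ K hK hlip htaylor hgrad using fun i => exists_gradient_bounds (hsmooth i)
  let G : ι → E × F → E := fun i t => gradient (fun y => φ i y t.2) t.1
  have hGcont : ∀ i, ContinuousAt (G i) (xb, pb) := by
    intro i
    have h1 : Tendsto (fun t : E × F => K i * (‖t.1 - xb‖ + ‖t.2 - pb‖)) (𝓝 (xb, pb)) (𝓝 0) := by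
      have : ContinuousAt (fun t : E × F => K i * (‖t.1 - xb‖ + ‖t.2 - pb‖)) (xb, pb) := by
        fun_prop
      simpa [ContinuousAt] using this
    rw [ContinuousAt, tendsto_iff_norm_sub_tendsto_zero]
    refine squeeze_zero' (Eventually.of_forall fun _ => norm_nonneg _) ?_ h1
    filter_upwards [prod_mem_nhds (ball_mem_nhds xb (hr₀ i)) (ball_mem_nhds pb (hr₀ i))] with t ht
    exact hgrad i t.1 ht.1 xb (mem_ball_self (hr₀ i)) t.2 ht.2 pb (mem_ball_self (hr₀ i))
  have hφcont : ∀ i, ContinuousAt (fun t : E × F => φ i t.1 t.2) (xb, pb) :=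
    fun i => (hsmooth i).continuousAt
  obtain ⟨A, hAK, hA0⟩ := ((eventually_all.2 fun i => eventually_ge_atTop (K i)).and
    (eventually_gt_atTop (0 : ℝ))).exists
  have hdescent : ∀ i, ∃ c > 0, φ i xb pb = 0 → ⟪G i (xb, pb), d₀⟫ ≤ -c := by
    intro i
    by_cases hi : φ i xb pb = 0
    · exact ⟨-⟪G i (xb, pb), d₀⟫, neg_pos.2 (hd₀ i hi), fun _ => by simp⟩
    · exact ⟨1, one_pos, fun h => absurd h hi⟩
  choose c hc hcd using hdescent
  obtain ⟨B, hBc, hB0⟩ := ((eventually_all.2 fun i => eventually_ge_atTop (2 / c i)).and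
    (eventually_gt_atTop (0 : ℝ))).exists
  have hdesc : ∀ i, φ i xb pb = 0 → ∀ᶠ t in 𝓝 (xb, pb), ⟪G i t, B • d₀⟫ ≤ -1 := by
    intro i hi
    have h1 : ContinuousAt (fun t => ⟪G i t, B • d₀⟫) (xb, pb) := (hGcont i).inner continuousAt_const
    refine (h1.eventually_lt_const ?_).mono fun t ht => ht.le
    simp only [inner_smul_right]
    have h2 := hcd i hi
    have h3 := (div_le_iff₀ (hc i)).1 (hBc i)
    nlinarith
  have hinactive : ∀ i, φ i xb pb ≠ 0 → ∀ᶠ t : E × F in 𝓝 (xb, pb), φ i t.1 t.2 < 0 :=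
    fun i hi => (hφcont i).eventually_lt_const (lt_of_le_of_ne (hxb i) hi)
  have hindep : ∀ J : Finset ι, ∃ κ > 0, LinearIndepOn ℝ (fun i => G i (xb, pb)) (J : Set ι) →
      ∀ᶠ t in 𝓝 (xb, pb), ∀ μ : ι → ℝ, (∀ i, i ∉ J → μ i = 0) →
        κ * ∑ i, |μ i| ≤ ‖∑ i, μ i • G i t‖ := by
    intro J
    by_cases hJ : LinearIndepOn ℝ (fun i => G i (xb, pb)) (J : Set ι)
    · obtain ⟨κ, hκ, h⟩ := exists_sum_abs_le_norm_sum hGcont hJ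
      exact ⟨κ, hκ, fun _ => h⟩
    · exact ⟨1, one_pos, fun h => absurd h hJ⟩
  choose κ₀ hκ₀ hκindep using hindep
  obtain ⟨κ, hκle, hκ⟩ : ∃ κ, (∀ J, κ ≤ κ₀ J) ∧ 0 < κ :=
    ((eventually_all.2 fun J => nhdsWithin_le_nhds (eventually_le_nhds (hκ₀ J))).and
      (self_mem_nhdsWithin (s := Ioi (0 : ℝ)))).exists
  have hnhds : ∀ᶠ t : E × F in 𝓝 (xb, pb), t ∈ W ∧
      (∀ i, φ i xb pb = 0 → ⟪G i t, B • d₀⟫ ≤ -1) ∧ (∀ i, φ i xb pb ≠ 0 → φ i t.1 t.2 < 0) ∧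
      ∀ J : Finset ι, LinearIndepOn ℝ (fun i => G i (xb, pb)) (J : Set ι) →
        ∀ μ : ι → ℝ, (∀ i, i ∉ J → μ i = 0) → κ₀ J * ∑ i, |μ i| ≤ ‖∑ i, μ i • G i t‖ := by
    refine Filter.Eventually.and hW ((eventually_all.2 fun i => ?_).and
      ((eventually_all.2 fun i => ?_).and (eventually_all.2 fun J => ?_)))
    · exact eventually_imp_distrib_left.2 (hdesc i)
    · exact eventually_imp_distrib_left.2 (hinactive i)
    · exact eventually_imp_distrib_left.2 (hκindep J)
  obtain ⟨r₁, hr₁, hball⟩ := Metric.eventually_nhds_iff_ball.1 hnhds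
  obtain ⟨r, ⟨hrle, hrr₁⟩, hr⟩ : ∃ r, ((∀ i, r ≤ r₀ i) ∧ r ≤ r₁) ∧ 0 < r :=
    (((eventually_all.2 fun i => nhdsWithin_le_nhds (eventually_le_nhds (hr₀ i))).and
      (nhdsWithin_le_nhds (eventually_le_nhds hr₁))).and
      (self_mem_nhdsWithin (s := Ioi (0 : ℝ)))).exists
  have hmem : ∀ {x p}, x ∈ ball xb r → p ∈ ball pb r → (x, p) ∈ ball (xb, pb) r₁ := by
    intro x p hx hp
    rw [← ball_prod_same]
    exact ⟨ball_subset_ball hrr₁ hx, ball_subset_ball hrr₁ hp⟩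
  have hx₀ : ∀ i, ball xb r ⊆ ball xb (r₀ i) := fun i => ball_subset_ball (hrle i)
  have hp₀ : ∀ i, ball pb r ⊆ ball pb (r₀ i) := fun i => ball_subset_ball (hrle i)
  refine ⟨B • d₀, r, A, A, κ, hr, hA0, hA0, hκ, ?_, ?_, ?_, ?_, ?_⟩
  · intro i x hx p hp q hq
    exact (hlip i x (hx₀ i hx) p (hp₀ i hp) q (hp₀ i hq)).trans
      (mul_le_mul_of_nonneg_right (hAK i) (norm_nonneg _))
  · intro i p hp x hx y hy
    exact (htaylor i p (hp₀ i hp) x (hx₀ i hx) y (hx₀ i hy)).trans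
      (mul_le_mul_of_nonneg_right (hAK i) (sq_nonneg _))
  · intro i x hx y hy p hp q hq
    exact (hgrad i x (hx₀ i hx) y (hx₀ i hy) p (hp₀ i hp) q (hp₀ i hq)).trans
      (mul_le_mul_of_nonneg_right (hAK i) (by positivity))
  · intro i
    by_cases hi : φ i xb pb = 0
    · exact Or.inr fun x hx p hp => (hball _ (hmem hx hp)).2.1 i hi
    · exact Or.inl fun x hx p hp => (hball _ (hmem hx hp)).2.2.1 i hi
  · rintro J ⟨x, hx, p, hp, hact, hli⟩ y hy q hq μ hμ
    have hact₀ : ∀ i ∈ J, φ i xb pb = 0 := by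
      intro i hi
      by_contra h
      exact ((hball _ (hmem hx hp)).2.2.1 i h).ne (hact i hi)
    have hli₀ : LinearIndepOn ℝ (fun i => G i (xb, pb)) (J : Set ι) :=
      linearIndepOn_of_finrank_span_eq hli
        (hrank J hact₀ (x, p) (hball _ (hmem hx hp)).1 (xb, pb) (mem_of_mem_nhds hW))
    exact (mul_le_mul_of_nonneg_right (hκle J) (Finset.sum_nonneg fun i _ => abs_nonneg _)).trans
      ((hball _ (hmem hy hq)).2.2.2 J hli₀ μ hμ)

end ConstraintSystem

/-- Lipschitz-like property of the graphical normal cone mapping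
under partial MFCQ and CRCQ (Proposition 9.2). -/
theorem statement17 {n l s : ℕ}
    (φ : Fin s → EuclideanSpace ℝ (Fin n) → EuclideanSpace ℝ (Fin l) → ℝ)
    (xb : EuclideanSpace ℝ (Fin n)) (pb : EuclideanSpace ℝ (Fin l))
    (vh : EuclideanSpace ℝ (Fin n))
    (hsmooth : ∀ i, ContDiffAt ℝ 2
      (fun t : EuclideanSpace ℝ (Fin n) × EuclideanSpace ℝ (Fin l) => φ i t.1 t.2) (xb, pb))
    (C : EuclideanSpace ℝ (Fin l) → Set (EuclideanSpace ℝ (Fin n)))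
    (hC : ∀ p, C p = {x | ∀ i, φ i x p ≤ 0})
    (hxb : xb ∈ C pb)
    (hMFCQ : ∃ d : EuclideanSpace ℝ (Fin n), ∀ i, φ i xb pb = 0 →
      ⟪gradient (fun y => φ i y pb) xb, d⟫ < 0)
    (hCRCQ : ∃ Wn ∈ 𝓝 (xb, pb), ∀ J : Finset (Fin s), (∀ i ∈ J, φ i xb pb = 0) →
      ∀ t₁ ∈ Wn, ∀ t₂ ∈ Wn,
        Module.finrank ℝ ↥(Submodule.span ℝ
            ((fun i => gradient (fun y => φ i y t₁.2) t₁.1) '' (J : Set (Fin s))))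
          = Module.finrank ℝ ↥(Submodule.span ℝ
            ((fun i => gradient (fun y => φ i y t₂.2) t₂.1) '' (J : Set (Fin s)))))
    (hvh : vh ∈ limNC (C pb) xb) :
    LipschitzLike
      (fun p => {t : EuclideanSpace ℝ (Fin n) × EuclideanSpace ℝ (Fin n) |
        t.2 ∈ limNC (C p) t.1}) pb (xb, vh) := by
  obtain rfl : C = fun p => {x | ∀ i, φ i x p ≤ 0} := funext hC
  obtain ⟨d, r, M, L, κ, h⟩ := exists_constraintBounds hsmooth hxb hMFCQ hCRCQ
  exact h.lipschitzLike_limNC vh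

end PVS
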